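/- A Banach space X is not superreflexive if and only if the infinite lamplighter group Z_2 ≀ Z, equipped with the word metric ρ with respect to the generating set {t, ta}, admits a bilipschitz embedding into X with some finite distortion. -/

import Mathlib

open scoped symmDiff

/-- Elements of the infinite lamplighter group `Z₂ ≀ Z`: a finite set of lit lamps
and a position. -/
abbrev LampZ := Finset ℤ × ℤ

/-- Group multiplication `(x,g)·(y,h) = (x △ (g+y), g+h)`. -/
def lampZMul (u v : LampZ) : LampZ :=
  (u.1 ∆ (v.1.image (u.2 + ·)), u.2 + v.2)

/-- Group inverse. -/
def lampZInv (u : LampZ) : LampZ :=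
  (u.1.image (· - u.2), -u.2)

/-- The generator `t = (∅, 1)`. -/
def lampZT : LampZ := (∅, 1)

/-- The generator `a = ({0}, 0)`. -/
def lampZA : LampZ := ({0}, 0)

/-- The generator `ta`. -/
def lampZTA : LampZ := lampZMul lampZT lampZA

/-- Word metric on `Z₂ ≀ Z` w.r.t. a generating set `S`. -/
noncomputable def wordDistZ (S : Set LampZ) (u v : LampZ) : ℕ :=
  sInf {m | ∃ w : List LampZ, w.length = m ∧
    (∀ s ∈ w, s ∈ S ∨ ∃ g ∈ S, s = lampZInv g) ∧ v = w.foldl lampZMul u}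

/-- The word metric `ρ` on `Z₂ ≀ Z` w.r.t. `{t, ta}`. -/
noncomputable def lampZDist (u v : LampZ) : ℕ :=
  wordDistZ {lampZT, lampZTA} u v

/-- "X admits an equivalent uniformly convex norm" (= superreflexivity, by Enflo). -/
def HasEquivUnifConvexNorm (X : Type*) [NormedAddCommGroup X] [NormedSpace ℝ X] : Prop :=
  ∃ N : X → ℝ,
    (∀ x, N x = 0 ↔ x = 0) ∧
    (∀ (c : ℝ) (x : X), N (c • x) = |c| * N x) ∧
    (∀ x y, N (x + y) ≤ N x + N y) ∧
    (∃ c₁ > (0 : ℝ), ∃ c₂ > (0 : ℝ), ∀ x, c₁ * ‖x‖ ≤ N x ∧ N x ≤ c₂ * ‖x‖) ∧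
    (∀ ε > (0 : ℝ), ∃ δ > (0 : ℝ), ∀ x y,
      N x ≤ 1 → N y ≤ 1 → ε ≤ N (x - y) → N (x + y) ≤ 2 - δ)

namespace LampAux

/-! The lamplighter word metric -/

/-- A letter is a generator or an inverse of one. -/
def Letter (s : LampZ) : Prop :=
  s ∈ ({lampZT, lampZTA} : Set LampZ) ∨ ∃ g ∈ ({lampZT, lampZTA} : Set LampZ), s = lampZInv g

/-- `v` is one step above `u`. -/
def Up (u v : LampZ) : Prop := v.2 = u.2 + 1 ∧ ∀ j, j ≠ u.2 + 1 → (j ∈ v.1 ↔ j ∈ u.1)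

theorem ta_eq : lampZTA = ({1}, 1) := by
  simp [lampZTA, lampZMul, lampZT, lampZA]

theorem letter_iff (s : LampZ) :
    Letter s ↔ s = (∅, 1) ∨ s = ({1}, 1) ∨ s = (∅, -1) ∨ s = ({0}, -1) := by
  unfold Letter
  rw [ta_eq]
  simp [lampZT, lampZInv]
  tauto

theorem step_cases (u s : LampZ) (hs : Letter s) :
    Up u (lampZMul u s) ∨ Up (lampZMul u s) u := by
  rw [letter_iff] at hs
  rcases hs with rfl | rfl | rfl | rfl
  · left; simp [Up, lampZMul, Finset.mem_symmDiff]
  · left; simp [Up, lampZMul, Finset.mem_symmDiff]; tauto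
  · right; simp [Up, lampZMul, Finset.mem_symmDiff]
  · right; simp [Up, lampZMul, Finset.mem_symmDiff]; tauto

theorem up_step (u v : LampZ) (h : Up u v) : ∃ s, Letter s ∧ v = lampZMul u s := by
  obtain ⟨x, g⟩ := u
  obtain ⟨y, k⟩ := v
  obtain ⟨h1, h2⟩ := h
  simp only at h1 h2
  subst h1
  by_cases hm : (g + 1 ∈ y ↔ g + 1 ∈ x)
  · refine ⟨(∅, 1), by simp [letter_iff], ?_⟩
    have : y = x := by
      ext j
      by_cases hj : j = g + 1
      · subst hj; exact hm
      · exact h2 j hj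
    simp only [lampZMul, this]
    ext <;> simp [Finset.mem_symmDiff]
  · refine ⟨({1}, 1), by simp [letter_iff], ?_⟩
    have : y = x ∆ {g + 1} := by
      ext j
      by_cases hj : j = g + 1
      · subst hj; simp [Finset.mem_symmDiff]; tauto
      · simp [Finset.mem_symmDiff, hj, h2 j hj]
    simp [lampZMul, this]

theorem down_step (u v : LampZ) (h : Up v u) : ∃ s, Letter s ∧ v = lampZMul u s := by
  obtain ⟨x, g⟩ := u
  obtain ⟨y, k⟩ := v
  obtain ⟨h1, h2⟩ := h
  simp only at h1 h2
  subst h1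
  by_cases hm : (k + 1 ∈ x ↔ k + 1 ∈ y)
  · refine ⟨(∅, -1), by simp [letter_iff], ?_⟩
    have : x = y := by
      ext j
      by_cases hj : j = k + 1
      · subst hj; exact hm
      · exact h2 j hj
    simp only [lampZMul, this]
    ext <;> simp [Finset.mem_symmDiff]
  · refine ⟨({0}, -1), by simp [letter_iff], ?_⟩
    have : y = x ∆ {k + 1} := by
      ext j
      by_cases hj : j = k + 1
      · subst hj; simp [Finset.mem_symmDiff]; tauto
      · simp [Finset.mem_symmDiff, hj, h2 j hj]
    simp [lampZMul, this]

/-- `v` can be reached from `u` by a word of length `n`. -/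
def Reach (u v : LampZ) (n : ℕ) : Prop :=
  ∃ w : List LampZ, w.length = n ∧ (∀ s ∈ w, Letter s) ∧ v = w.foldl lampZMul u

theorem dist_def (u v : LampZ) : lampZDist u v = sInf {m | Reach u v m} := rfl

theorem dist_le {u v : LampZ} {n : ℕ} (h : Reach u v n) : lampZDist u v ≤ n := by
  rw [dist_def]; exact Nat.sInf_le h

theorem reach_dist {u v : LampZ} {n : ℕ} (h : Reach u v n) : Reach u v (lampZDist u v) := by
  rw [dist_def]; exact Nat.sInf_mem (s := {m | Reach u v m}) ⟨n, h⟩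

theorem Reach.refl (u : LampZ) : Reach u u 0 := ⟨[], rfl, by simp, rfl⟩

theorem Reach.trans {u v z : LampZ} {m n : ℕ} (h : Reach u v m) (h' : Reach v z n) :
    Reach u z (m + n) := by
  obtain ⟨w, rfl, hw, rfl⟩ := h
  obtain ⟨w', rfl, hw', rfl⟩ := h'
  refine ⟨w ++ w', by simp, ?_, by simp⟩
  intro s hs
  rcases List.mem_append.1 hs with hs | hs
  · exact hw s hs
  · exact hw' s hs

theorem Reach.step {u v : LampZ} (h : Up u v ∨ Up v u) : Reach u v 1 := by
  have : ∃ s, Letter s ∧ v = lampZMul u s := by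
    rcases h with h | h
    · exact up_step u v h
    · exact down_step u v h
  obtain ⟨s, hs, rfl⟩ := this
  exact ⟨[s], rfl, by simpa using hs, rfl⟩

/-- Induction principle for reachability. -/
theorem Reach.cases_succ {u v : LampZ} {n : ℕ} (h : Reach u v (n + 1)) :
    ∃ z, (Up u z ∨ Up z u) ∧ Reach z v n := by
  obtain ⟨w, hl, hw, rfl⟩ := h
  cases w with
  | nil => simp at hl
  | cons s w =>
    refine ⟨lampZMul u s, step_cases u s (hw s (by simp)), w, by simpa using hl, ?_, rfl⟩
    intro s' hs'
    exact hw s' (by simp [hs'])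

theorem Reach.zero {u v : LampZ} (h : Reach u v 0) : v = u := by
  obtain ⟨w, hl, hw, rfl⟩ := h
  have : w = [] := List.length_eq_zero_iff.1 hl
  subst this; rfl

theorem reach_lower (n : ℕ) : ∀ u v : LampZ, Reach u v n →
    |v.2 - u.2| ≤ n ∧
    ∀ j, ¬ (j ∈ u.1 ↔ j ∈ v.1) → (u.2 - j + 1) + (v.2 - j + 1) ≤ n := by
  induction n with
  | zero =>
    intro u v h
    have := h.zero
    subst this
    simp
  | succ n ih =>
    intro u v h
    obtain ⟨z, hz, hr⟩ := h.cases_succ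
    obtain ⟨h1, h2⟩ := ih z v hr
    rw [abs_le] at h1
    refine ⟨?_, ?_⟩
    · rw [abs_le]
      rcases hz with hz | hz <;> have := hz.1 <;> push_cast <;> constructor <;> omega
    · intro j hj
      by_cases hjz : (j ∈ z.1 ↔ j ∈ v.1)
      · rcases hz with hz | hz
        · have h3 := hz.1
          by_cases hju : j = u.2 + 1
          · push_cast; omega
          · exact absurd ((hz.2 j hju).symm.trans hjz) hj
        · have h3 := hz.1
          by_cases hju : j = z.2 + 1
          · push_cast; omega
          · exact absurd ((hz.2 j hju).trans hjz) hj
      · have := h2 j hjz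
        rcases hz with hz | hz <;> have := hz.1 <;> push_cast <;> omega

theorem reach_down (x : Finset ℤ) (n : ℕ) : ∀ g : ℤ, Reach (x, g) (x, g - n) n := by
  induction n with
  | zero => intro g; simpa using Reach.refl (x, g)
  | succ n ih =>
    intro g
    have h1 : Reach (x, g) (x, g - 1) 1 := Reach.step (Or.inr (by simp [Up]))
    have h2 := h1.trans (ih (g - 1))
    have e : g - 1 - (n : ℤ) = g - ((n + 1 : ℕ) : ℤ) := by push_cast; ring
    rw [e, add_comm 1 n] at h2
    exact h2

theorem reach_up (n : ℕ) : ∀ (x y : Finset ℤ) (g : ℤ),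
    (∀ j, ¬ (j ∈ x ↔ j ∈ y) → g < j ∧ j ≤ g + n) → Reach (x, g) (y, g + n) n := by
  induction n with
  | zero =>
    intro x y g h
    have : x = y := by
      ext j
      by_contra hj
      have := h j hj
      simp at this
      omega
    subst this
    simpa using Reach.refl (x, g)
  | succ n ih =>
    intro x y g h
    let z : Finset ℤ := if (g + 1 ∈ x ↔ g + 1 ∈ y) then x else x ∆ {g + 1}
    have hz1 : ∀ j, j ≠ g + 1 → (j ∈ z ↔ j ∈ x) := by
      intro j hj
      by_cases hc : (g + 1 ∈ x ↔ g + 1 ∈ y)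
      · simp [z, hc]
      · simp only [z, hc, if_false]; simp [Finset.mem_symmDiff, hj]
    have hz2 : (g + 1 ∈ z ↔ g + 1 ∈ y) := by
      by_cases hc : (g + 1 ∈ x ↔ g + 1 ∈ y)
      · simp only [z]; rw [if_pos hc]; exact hc
      · simp only [z]; rw [if_neg hc]; simp [Finset.mem_symmDiff]; tauto
    have h1 : Reach (x, g) (z, g + 1) 1 := Reach.step (Or.inl ⟨rfl, hz1⟩)
    have h2 := h1.trans (ih z y (g + 1) (by
      intro j hj
      by_cases hjg : j = g + 1
      · subst hjg; exact absurd hz2 hj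
      · rw [hz1 j hjg] at hj
        have := h j hj
        push_cast at this
        omega))
    have e : g + 1 + (n : ℤ) = g + ((n + 1 : ℕ) : ℤ) := by push_cast; ring
    rw [e, add_comm 1 n] at h2
    exact h2

/-- The word used for the upper bound of the metric. -/
theorem reach_upper (u v : LampZ) (lo hi : ℤ) (h1 : lo ≤ u.2) (h2 : lo ≤ v.2) (h3 : u.2 ≤ hi)
    (h4 : v.2 ≤ hi) (h : ∀ j, ¬ (j ∈ u.1 ↔ j ∈ v.1) → lo < j ∧ j ≤ hi) :
    Reach u v ((u.2 - lo) + (hi - lo) + (hi - v.2)).toNat := by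
  obtain ⟨x, g⟩ := u
  obtain ⟨y, k⟩ := v
  simp only at *
  have r1 := reach_down x (g - lo).toNat g
  have r2 := reach_up (hi - lo).toNat x y lo (by
    intro j hj
    have := h j hj
    omega)
  have r3 := reach_down y (hi - k).toNat hi
  have e1 : g - ((g - lo).toNat : ℤ) = lo := by omega
  have e2 : lo + ((hi - lo).toNat : ℤ) = hi := by omega
  have e3 : hi - ((hi - k).toNat : ℤ) = k := by omega
  rw [e1] at r1; rw [e2] at r2; rw [e3] at r3
  have := (r1.trans r2).trans r3
  have e : (g - lo).toNat + (hi - lo).toNat + (hi - k).toNat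
    = ((g - lo) + (hi - lo) + (hi - k)).toNat := by omega
  rwa [e] at this

theorem exists_reach (u v : LampZ) : ∃ n, Reach u v n := by
  let S : Finset ℤ := insert u.2 (insert v.2 (u.1 ∪ v.1))
  have hS : S.Nonempty := ⟨u.2, by simp [S]⟩
  have hle : ∀ j ∈ S, S.min' hS - 1 < j ∧ j ≤ S.max' hS := fun j hj =>
    ⟨by have := S.min'_le j hj; omega, S.le_max' j hj⟩
  refine ⟨_, reach_upper u v (S.min' hS - 1) (S.max' hS) ?_ ?_ ?_ ?_ ?_⟩
  · exact (hle u.2 (by simp [S])).1.le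
  · exact (hle v.2 (by simp [S])).1.le
  · exact (hle u.2 (by simp [S])).2
  · exact (hle v.2 (by simp [S])).2
  · intro j hj
    apply hle
    simp only [S, Finset.mem_insert, Finset.mem_union]
    tauto

theorem reach_lampZDist (u v : LampZ) : Reach u v (lampZDist u v) := by
  obtain ⟨n, hn⟩ := exists_reach u v
  exact reach_dist hn

/-! The binary tree in the lamplighter group -/

/-- Tree nodes as group elements. -/
def node : List Bool → LampZ
  | [] => (∅, 0)
  | b :: w => ((if b then insert ((w.length : ℤ) + 1) (node w).1 else (node w).1), (w.length : ℤ) + 1)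

theorem node_snd (w : List Bool) : (node w).2 = w.length := by
  cases w <;> simp [node]

theorem mem_node_le (w : List Bool) : ∀ j ∈ (node w).1, j ≤ w.length := by
  induction w with
  | nil => simp [node]
  | cons b w ih =>
    intro j hj
    cases b
    · simp [node] at hj
      have := ih j hj
      simp; omega
    · simp [node] at hj
      rcases hj with rfl | hj
      · simp
      · have := ih j hj
        simp; omega

theorem mem_node_append (u w : List Bool) (j : ℤ) (hj : j ≤ w.length) :
    j ∈ (node (u ++ w)).1 ↔ j ∈ (node w).1 := by
  induction u with
  | nil => simp
  | cons b u ih =>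
    rw [← ih]
    cases b
    · simp [node]
    · simp [node]; omega

theorem dist_node_edge (b : Bool) (w : List Bool) : lampZDist (node (b :: w)) (node w) ≤ 1 := by
  apply dist_le
  apply Reach.step
  right
  refine ⟨?_, ?_⟩
  · simp [node_snd]
  · intro j hj
    rw [node_snd] at hj
    cases b <;> simp [node, hj]

theorem dist_node_lower (u u' w : List Bool) (h : u.length = u'.length) :
    2 * (u.length + 1) ≤ lampZDist (node (u ++ true :: w)) (node (u' ++ false :: w)) := by
  have hr := reach_lampZDist (node (u ++ true :: w)) (node (u' ++ false :: w))
  have := (reach_lower _ _ _ hr).2 ((w.length : ℤ) + 1) (by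
    rw [mem_node_append _ _ _ (by simp), mem_node_append _ _ _ (by simp)]
    simp only [node, if_true]
    intro hh
    have : ((w.length : ℤ) + 1) ∈ (node w).1 := by simpa using hh
    have := mem_node_le w _ this
    omega)
  rw [node_snd, node_snd] at this
  simp at this
  omega

end LampAux

namespace LampAux

/-! Trees do not embed in uniformly convex spaces (Kloeckner self-improvement argument) -/

/-- The infinite binary tree embeds with co-Lipschitz constant one, Lipschitz constant `C`. -/
def TreeEmb {X : Type*} [NormedAddCommGroup X] [NormedSpace ℝ X] (N : X → ℝ) (C : ℝ) : Prop :=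
  ∃ f : List Bool → X, (∀ b w, N (f (b :: w) - f w) ≤ C) ∧
    ∀ u u' w, u.length = u'.length →
      2 * ((u.length : ℝ) + 1) ≤ N (f (u ++ true :: w) - f (u' ++ false :: w))

/-- Passing to a good subtree. -/
def subTree (k : Bool → List Bool → Bool) : List Bool → List Bool
  | [] => []
  | b :: w => k b (subTree k w) :: b :: subTree k w

theorem subTree_append (k : Bool → List Bool → Bool) (u : List Bool) (b : Bool) (w : List Bool) :
    ∃ u', subTree k (u ++ b :: w) = u' ++ b :: subTree k w ∧ u'.length = 2 * u.length + 1 := by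
  induction u with
  | nil => exact ⟨[k b (subTree k w)], by simp [subTree], by simp⟩
  | cons c u ih =>
    obtain ⟨u', h1, h2⟩ := ih
    refine ⟨k c (subTree k (u ++ b :: w)) :: c :: u', ?_, ?_⟩
    · simp [subTree, h1]
    · simp [h2]; ring

theorem treeEmb_improve {X : Type*} [NormedAddCommGroup X] [NormedSpace ℝ X] (N : X → ℝ)
    (hsm : ∀ (c : ℝ) (x : X), N (c • x) = |c| * N x) (htri : ∀ x y, N (x + y) ≤ N x + N y)
    (C ε δ : ℝ) (hC : 0 < C) (hCε : C * ε ≤ 1)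
    (huc : ∀ x y, N x ≤ 1 → N y ≤ 1 → ε ≤ N (x - y) → N (x + y) ≤ 2 - δ)
    (h : TreeEmb N C) : TreeEmb N (C * (1 - δ / 2)) := by
  obtain ⟨f, hf, hl⟩ := h
  have hkey : ∀ (b : Bool) (v : List Bool), ∃ k : Bool,
      N (f (k :: b :: v) - f v) ≤ C * (2 - δ) := by
    intro b v
    by_contra! hcon
    have hq : ∀ k, N ((C⁻¹ • (f (b :: v) - f v)) - C⁻¹ • (f (k :: b :: v) - f (b :: v))) < ε := by
      intro k
      by_contra! hk
      have h1 := huc (C⁻¹ • (f (b :: v) - f v)) (C⁻¹ • (f (k :: b :: v) - f (b :: v)))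
        (by rw [hsm, abs_of_pos (inv_pos.2 hC), inv_mul_le_iff₀ hC]; simpa using hf b v)
        (by rw [hsm, abs_of_pos (inv_pos.2 hC), inv_mul_le_iff₀ hC]; simpa using hf k (b :: v)) hk
      rw [← smul_add, hsm, abs_of_pos (inv_pos.2 hC), inv_mul_le_iff₀ hC] at h1
      have e : f (b :: v) - f v + (f (k :: b :: v) - f (b :: v)) = f (k :: b :: v) - f v := by abel
      rw [e] at h1
      linarith [hcon k]
    have h2 := hl [] [] (b :: v) rfl
    have e : f ([] ++ true :: b :: v) - f ([] ++ false :: b :: v) =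
      C • (((C⁻¹ • (f (b :: v) - f v)) - C⁻¹ • (f (false :: b :: v) - f (b :: v))) +
        (-1 : ℝ) • ((C⁻¹ • (f (b :: v) - f v)) - C⁻¹ • (f (true :: b :: v) - f (b :: v)))) := by
      rw [← smul_sub, ← smul_sub, smul_comm, ← smul_add, smul_smul, mul_inv_cancel₀ hC.ne']
      simp
    rw [e, hsm, abs_of_pos hC] at h2
    have h3 := htri ((C⁻¹ • (f (b :: v) - f v)) - C⁻¹ • (f (false :: b :: v) - f (b :: v)))
      ((-1 : ℝ) • ((C⁻¹ • (f (b :: v) - f v)) - C⁻¹ • (f (true :: b :: v) - f (b :: v))))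
    rw [hsm] at h3
    have h4 := hq true
    have h5 := hq false
    simp at h2 h3
    nlinarith
  choose k hk using hkey
  refine ⟨fun w => (1 / 2 : ℝ) • f (subTree k w), ?_, ?_⟩
  · intro b w
    have := hk b (subTree k w)
    rw [← smul_sub, hsm]
    simp only [subTree]
    rw [abs_of_pos (by norm_num)]
    linarith
  · intro u u' w huu
    obtain ⟨a, ha, hal⟩ := subTree_append k u true w
    obtain ⟨a', ha', hal'⟩ := subTree_append k u' false w
    have := hl a a' (subTree k w) (by omega)
    simp only
    rw [ha, ha', ← smul_sub, hsm, abs_of_pos (by norm_num)]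
    rw [hal] at this
    push_cast at this
    linarith

theorem not_treeEmb {X : Type*} [NormedAddCommGroup X] [NormedSpace ℝ X] (N : X → ℝ)
    (hsm : ∀ (c : ℝ) (x : X), N (c • x) = |c| * N x) (htri : ∀ x y, N (x + y) ≤ N x + N y)
    (huc : ∀ ε > (0 : ℝ), ∃ δ > (0 : ℝ), ∀ x y,
      N x ≤ 1 → N y ≤ 1 → ε ≤ N (x - y) → N (x + y) ≤ 2 - δ) (C : ℝ) : ¬ TreeEmb N C := by
  intro hC
  let S : Set ℝ := {C | TreeEmb N C}
  have hlow : ∀ c ∈ S, (1 : ℝ) ≤ c := by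
    rintro c ⟨f, hf, hl⟩
    have h1 := hl [] [] [] rfl
    have h2 := htri (f [true] - f []) ((-1 : ℝ) • (f [false] - f []))
    have e : f [true] - f [] + (-1 : ℝ) • (f [false] - f []) = f [true] - f [false] := by simp
    rw [e, hsm] at h2
    have h3 := hf true []
    have h4 := hf false []
    simp at h1 h2
    linarith
  have hbdd : BddBelow S := ⟨1, fun c hc => hlow c hc⟩
  have hne : S.Nonempty := ⟨C, hC⟩
  set m := sInf S with hm
  have hm1 : 1 ≤ m := le_csInf hne hlow
  obtain ⟨δ, hδ, hδ'⟩ := huc (1 / (m + 1)) (by positivity)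
  obtain ⟨c, hc, hcm⟩ := exists_lt_of_csInf_lt hne
    (show sInf S < m + min 1 (δ / 4) by
      rw [← hm]; have : 0 < min 1 (δ / 4) := lt_min one_pos (by positivity)
      linarith)
  have hc1 : c < m + 1 := lt_of_lt_of_le hcm (by gcongr; exact min_le_left _ _)
  have hc2 : c < m + δ / 4 := lt_of_lt_of_le hcm (by gcongr; exact min_le_right _ _)
  have hcpos : 1 ≤ c := hlow c hc
  have := treeEmb_improve N hsm htri c _ δ (by linarith)
    (by rw [mul_one_div, div_le_one (by linarith)]; exact hc1.le) hδ' hc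
  have h2 : m ≤ c * (1 - δ / 2) := csInf_le hbdd this
  nlinarith

theorem not_uc_of_embeds {X : Type*} [NormedAddCommGroup X] [NormedSpace ℝ X]
    (D : ℝ) (hD : 1 ≤ D) (f : LampZ → X) (r : ℝ) (hr : 0 < r)
    (hf : ∀ u v : LampZ, r * (lampZDist u v : ℝ) ≤ ‖f u - f v‖ ∧
          ‖f u - f v‖ ≤ D * r * (lampZDist u v : ℝ)) : ¬ HasEquivUnifConvexNorm X := by
  rintro ⟨N, -, hsm, htri, ⟨c₁, hc₁, c₂, hc₂, hN⟩, huc⟩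
  have hp : 0 < (c₁ * r)⁻¹ := by positivity
  refine not_treeEmb N hsm htri huc ((c₁ * r)⁻¹ * (c₂ * (D * r)))
    ⟨fun w => (c₁ * r)⁻¹ • f (node w), ?_, ?_⟩
  · intro b w
    simp only
    rw [← smul_sub, hsm, abs_of_pos hp]
    refine mul_le_mul_of_nonneg_left ?_ hp.le
    refine (hN _).2.trans ?_
    gcongr
    refine (hf _ _).2.trans ?_
    have h1 : (lampZDist (node (b :: w)) (node w) : ℝ) ≤ 1 := by
      exact_mod_cast dist_node_edge b w
    have : 0 ≤ D * r := by positivity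
    nlinarith
  · intro u u' w huu
    simp only
    rw [← smul_sub, hsm, abs_of_pos hp, ← div_eq_inv_mul, le_div_iff₀ (by positivity)]
    refine le_trans ?_ (hN _).1
    have h1 : (2 * ((u.length : ℝ) + 1)) ≤
        lampZDist (node (u ++ true :: w)) (node (u' ++ false :: w)) := by
      exact_mod_cast dist_node_lower u u' w huu
    have h2 := (hf (node (u ++ true :: w)) (node (u' ++ false :: w))).1
    have : r * (2 * ((u.length : ℝ) + 1)) ≤
      ‖f (node (u ++ true :: w)) - f (node (u' ++ false :: w))‖ := le_trans (by gcongr) h2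
    nlinarith

end LampAux

namespace LampAux

/-! Renorming: spaces without deep bushes are uniformly convexifiable -/

section Renorm
variable {X : Type*} [NormedAddCommGroup X] [NormedSpace ℝ X]

/-- Iterated derivation of the unit ball: barycentres of measures with mean oscillation `≥ ε`. -/
def Der (X : Type*) [NormedAddCommGroup X] [NormedSpace ℝ X] (ε : ℝ) : ℕ → Set X
  | 0 => Metric.closedBall 0 1
  | k + 1 => {x | ∃ (ι : Type) (_ : Fintype ι) (w : ι → ℝ) (y : ι → X),
      (∀ i, 0 ≤ w i) ∧ ∑ i, w i = 1 ∧ (∀ i, y i ∈ Der X ε k) ∧ ∑ i, w i • y i = x ∧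
      ∀ c, ε ≤ ∑ i, w i * ‖y i - c‖}

theorem Der_convex (ε : ℝ) (k : ℕ) : Convex ℝ (Der X ε k) := by
  cases k with
  | zero => exact convex_closedBall _ _
  | succ k =>
    rintro x ⟨ι, _, w, y, hw, hw1, hy, rfl, hε⟩ x' ⟨ι', _, w', y', hw', hw1', hy', rfl, hε'⟩
      a b ha hb hab
    refine ⟨ι ⊕ ι', inferInstance, Sum.elim (fun i => a * w i) (fun i => b * w' i),
      Sum.elim y y', ?_, ?_, ?_, ?_, ?_⟩
    · rintro (i | i)
      · exact mul_nonneg ha (hw i)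
      · exact mul_nonneg hb (hw' i)
    · simp [Fintype.sum_sum_type, ← Finset.mul_sum, hw1, hw1', hab]
    · rintro (i | i)
      · exact hy i
      · exact hy' i
    · simp [Fintype.sum_sum_type, Finset.smul_sum, mul_smul]
    · intro c
      have h1 := hε c
      have h2 := hε' c
      simp only [Fintype.sum_sum_type, Sum.elim_inl, Sum.elim_inr, mul_assoc, ← Finset.mul_sum]
      calc ε = a * ε + b * ε := by rw [← add_mul, hab, one_mul]
        _ ≤ _ := by gcongr

theorem Der_neg (ε : ℝ) (k : ℕ) : ∀ x ∈ Der X ε k, -x ∈ Der X ε k := by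
  induction k with
  | zero => intro x hx; simpa [Der] using hx
  | succ k ih =>
    rintro x ⟨ι, _, w, y, hw, hw1, hy, rfl, hε⟩
    refine ⟨ι, inferInstance, w, fun i => - y i, hw, hw1, fun i => ih _ (hy i), by simp, ?_⟩
    intro c
    refine (hε (-c)).trans (le_of_eq ?_)
    refine Finset.sum_congr rfl fun i _ => ?_
    rw [show -y i - c = -(y i - -c) by abel, norm_neg]

theorem Der_mid (ε : ℝ) (k : ℕ) (x y : X) (hx : x ∈ Der X ε k) (hy : y ∈ Der X ε k)
    (h : 2 * ε ≤ ‖x - y‖) : (1 / 2 : ℝ) • (x + y) ∈ Der X ε (k + 1) := by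
  refine ⟨Bool, inferInstance, fun _ => 1 / 2, fun b => if b then x else y, by simp, by norm_num,
    ?_, by simp, ?_⟩
  · intro b; cases b
    · simpa using hy
    · simpa using hx
  · intro c
    have : ‖x - y‖ ≤ ‖x - c‖ + ‖y - c‖ := by
      have := norm_sub_le (x - c) (y - c)
      simpa using this
    simp
    linarith

theorem zero_mem_Der (ε : ℝ) (k : ℕ) (h : (Der X ε k).Nonempty) : (0 : X) ∈ Der X ε k := by
  obtain ⟨x, hx⟩ := h
  have := Der_convex ε k hx (Der_neg ε k x hx) (a := 1 / 2) (b := 1 / 2) (by norm_num)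
    (by norm_num) (by norm_num)
  simpa using this

theorem infDist_conv {s : Set X} (hs : Convex ℝ s) (hne : s.Nonempty) (x y : X) (a b : ℝ)
    (ha : 0 ≤ a) (hb : 0 ≤ b) (hab : a + b = 1) :
    Metric.infDist (a • x + b • y) s ≤ a * Metric.infDist x s + b * Metric.infDist y s := by
  apply le_of_forall_pos_le_add
  intro η hη
  obtain ⟨x', hx', h1⟩ := (Metric.infDist_lt_iff hne).1 (lt_add_of_pos_right (Metric.infDist x s) hη)
  obtain ⟨y', hy', h2⟩ := (Metric.infDist_lt_iff hne).1 (lt_add_of_pos_right (Metric.infDist y s) hη)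
  refine (Metric.infDist_le_dist_of_mem (hs hx' hy' ha hb hab)).trans ?_
  have : dist (a • x + b • y) (a • x' + b • y') ≤ a * dist x x' + b * dist y y' := by
    refine (dist_add_add_le _ _ _ _).trans ?_
    rw [dist_smul₀, dist_smul₀, Real.norm_of_nonneg ha, Real.norm_of_nonneg hb]
  refine this.trans ?_
  calc a * dist x x' + b * dist y y' ≤ a * (Metric.infDist x s + η) + b * (Metric.infDist y s + η) := by
        gcongr
    _ = a * Metric.infDist x s + b * Metric.infDist y s + (a + b) * η := by ring
    _ = _ := by rw [hab, one_mul]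

/-- A function which is uniformly convex at scale `ε`. -/
structure UCAt (ε : ℝ) (Φ : X → ℝ) : Prop where
  nonneg : ∀ x, 0 ≤ Φ x
  zero : Φ 0 = 0
  neg : ∀ x, Φ (-x) = Φ x
  conv : ∀ x y a b, 0 ≤ a → 0 ≤ b → a + b = 1 → Φ (a • x + b • y) ≤ a * Φ x + b * Φ y
  lip : ∀ x y, Φ x - Φ y ≤ ‖x - y‖
  uc : ∃ δ > 0, ∀ x y, ‖x‖ ≤ 1 → ‖y‖ ≤ 1 → 4 * ε ≤ ‖x - y‖ →
    Φ ((1 / 2 : ℝ) • (x + y)) ≤ (Φ x + Φ y) / 2 - δ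

theorem infDist_neg' {s : Set X} (hs : ∀ x ∈ s, -x ∈ s) (hne : s.Nonempty) (x : X) :
    Metric.infDist (-x) s ≤ Metric.infDist x s := by
  rw [Metric.le_infDist hne]
  intro y hy
  refine (Metric.infDist_le_dist_of_mem (hs y hy)).trans ?_
  rw [dist_neg_neg]

theorem exists_UCAt (ε : ℝ) (hε : 0 < ε) (h : ∃ n, Der X ε n = ∅) :
    ∃ Φ : X → ℝ, UCAt ε Φ := by
  classical
  let n := Nat.find h
  have hn : Der X ε n = ∅ := Nat.find_spec h
  have hne : ∀ k < n, (Der X ε k).Nonempty := fun k hk =>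
    Set.nonempty_iff_ne_empty.2 (Nat.find_min h hk)
  have hn0 : 0 < n := by
    rcases Nat.eq_zero_or_pos n with h0 | h0
    · rw [h0] at hn
      have : (0 : X) ∈ Der X ε 0 := by simp [Der]
      rw [hn] at this; exact this.elim
    · exact h0
  have hnR : (0 : ℝ) < n := by exact_mod_cast hn0
  let g : ℕ → X → ℝ := fun k x => Metric.infDist x (Der X ε k)
  have hg0 : ∀ k x, 0 ≤ g k x := fun k x => Metric.infDist_nonneg
  have hgc : ∀ k < n, ∀ x y a b, 0 ≤ a → 0 ≤ b → a + b = 1 →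
      g k (a • x + b • y) ≤ a * g k x + b * g k y := fun k hk x y a b ha hb hab =>
    infDist_conv (Der_convex ε k) (hne k hk) x y a b ha hb hab
  -- the key gap
  let δ : ℝ := ε / (4 * 2 ^ n)
  have hδ : 0 < δ := by positivity
  have hgap : ∀ x y : X, ‖x‖ ≤ 1 → ‖y‖ ≤ 1 → 4 * ε ≤ ‖x - y‖ →
      ∃ k < n, g k ((1 / 2 : ℝ) • (x + y)) ≤ (g k x + g k y) / 2 - δ := by
    intro x y hx hy hxy
    by_contra! hcon
    have hstep : ∀ k < n, g k x ≤ 4 * (2 ^ k - 1) * δ → g k y ≤ 4 * (2 ^ k - 1) * δ →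
        ∃ m' ∈ Der X ε (k + 1), dist ((1 / 2 : ℝ) • (x + y)) m' ≤ (4 * (2 ^ k - 1) + 1) * δ := by
      intro k hk h1 h2
      obtain ⟨x', hx', h1'⟩ := (Metric.infDist_lt_iff (hne k hk)).1 (lt_of_le_of_lt h1
        (show 4 * (2 ^ k - 1) * δ < (4 * (2 ^ k - 1) + 1) * δ by nlinarith))
      obtain ⟨y', hy', h2'⟩ := (Metric.infDist_lt_iff (hne k hk)).1 (lt_of_le_of_lt h2
        (show 4 * (2 ^ k - 1) * δ < (4 * (2 ^ k - 1) + 1) * δ by nlinarith))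
      have hsmall : (4 * (2 ^ k - 1) + 1) * δ ≤ ε := by
        have : (2 : ℝ) ^ k ≤ 2 ^ n := pow_le_pow_right₀ (by norm_num) hk.le
        have e : 4 * 2 ^ n * δ = ε := by simp only [δ]; field_simp
        nlinarith
      refine ⟨_, Der_mid ε k x' y' hx' hy' ?_, ?_⟩
      · have h5 : ‖x - y‖ ≤ dist x x' + ‖x' - y'‖ + dist y y' := by
          rw [← dist_eq_norm, ← dist_eq_norm, dist_comm y y']
          exact dist_triangle4 _ _ _ _
        linarith
      · rw [dist_smul₀, Real.norm_of_nonneg (by norm_num)]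
        have := dist_add_add_le x y x' y'
        linarith
    have hall : ∀ k, k < n → g k x ≤ 4 * (2 ^ k - 1) * δ ∧ g k y ≤ 4 * (2 ^ k - 1) * δ := by
      intro k
      induction k with
      | zero =>
        intro _
        have h1 : g 0 x = 0 := Metric.infDist_zero_of_mem (by simpa [Der] using hx)
        have h2 : g 0 y = 0 := Metric.infDist_zero_of_mem (by simpa [Der] using hy)
        simp [h1, h2]
      | succ k ih =>
        intro hk
        obtain ⟨h1, h2⟩ := ih (by omega)
        obtain ⟨m', hm', hd⟩ := hstep k (by omega) h1 h2
        have h3 : g (k + 1) ((1 / 2 : ℝ) • (x + y)) ≤ (4 * (2 ^ k - 1) + 1) * δ :=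
          (Metric.infDist_le_dist_of_mem hm').trans hd
        have h4 := hcon (k + 1) hk
        have h5 := hg0 (k + 1) x
        have h6 := hg0 (k + 1) y
        rw [pow_succ]
        constructor <;> nlinarith
    obtain ⟨h1, h2⟩ := hall (n - 1) (by omega)
    obtain ⟨m', hm', -⟩ := hstep (n - 1) (by omega) h1 h2
    rw [Nat.sub_add_cancel hn0, hn] at hm'
    exact hm'
  refine ⟨fun x => (n : ℝ)⁻¹ * ∑ k ∈ Finset.range n, g k x, ?_, ?_, ?_, ?_, ?_, ?_⟩
  · intro x
    have := Finset.sum_nonneg (s := Finset.range n) (fun k _ => hg0 k x)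
    positivity
  · rw [Finset.sum_eq_zero, mul_zero]
    intro k hk
    exact Metric.infDist_zero_of_mem (zero_mem_Der ε k (hne k (Finset.mem_range.1 hk)))
  · intro x
    congr 1
    refine Finset.sum_congr rfl fun k hk => le_antisymm ?_ ?_
    · exact infDist_neg' (Der_neg ε k) (hne k (Finset.mem_range.1 hk)) x
    · have := infDist_neg' (Der_neg ε k) (hne k (Finset.mem_range.1 hk)) (-x)
      rwa [neg_neg] at this
  · intro x y a b ha hb hab
    have : ∑ k ∈ Finset.range n, g k (a • x + b • y) ≤
        a * ∑ k ∈ Finset.range n, g k x + b * ∑ k ∈ Finset.range n, g k y := by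
      rw [Finset.mul_sum, Finset.mul_sum, ← Finset.sum_add_distrib]
      exact Finset.sum_le_sum fun k hk => hgc k (Finset.mem_range.1 hk) x y a b ha hb hab
    calc _ ≤ (n : ℝ)⁻¹ * (a * ∑ k ∈ Finset.range n, g k x + b * ∑ k ∈ Finset.range n, g k y) := by
          gcongr
      _ = _ := by ring
  · intro x y
    rw [← mul_sub, ← Finset.sum_sub_distrib, inv_mul_le_iff₀ hnR]
    calc _ ≤ ∑ k ∈ Finset.range n, ‖x - y‖ := by
          refine Finset.sum_le_sum fun k hk => ?_
          have : g k x ≤ g k y + dist x y := Metric.infDist_le_infDist_add_dist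
          rw [dist_eq_norm] at this
          linarith
      _ = _ := by simp
  · refine ⟨(n : ℝ)⁻¹ * δ, by positivity, ?_⟩
    intro x y hx hy hxy
    obtain ⟨k, hk, hkg⟩ := hgap x y hx hy hxy
    have hc : ∀ l < n, g l ((1 / 2 : ℝ) • (x + y)) ≤ (g l x + g l y) / 2 := by
      intro l hl
      have := hgc l hl x y (1 / 2) (1 / 2) (by norm_num) (by norm_num) (by norm_num)
      rw [smul_add]; linarith
    have : ∑ l ∈ Finset.range n, g l ((1 / 2 : ℝ) • (x + y)) ≤
        ∑ l ∈ Finset.range n, ((g l x + g l y) / 2 - if l = k then δ else 0) := by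
      refine Finset.sum_le_sum fun l hl => ?_
      split_ifs with hlk
      · subst hlk; exact hkg
      · simpa using hc l (Finset.mem_range.1 hl)
    rw [Finset.sum_sub_distrib, Finset.sum_ite_eq' , if_pos (Finset.mem_range.2 hk),
      ← Finset.sum_div, Finset.sum_add_distrib] at this
    calc _ ≤ (n : ℝ)⁻¹ * ((∑ l ∈ Finset.range n, g l x + ∑ l ∈ Finset.range n, g l y) / 2 - δ) := by
          gcongr
      _ = _ := by ring

end Renorm
end LampAux

namespace LampAux
section Renorm2
variable {X : Type*} [NormedAddCommGroup X] [NormedSpace ℝ X]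

theorem renorm_of_Psi (Ψ : X → ℝ) (hneg : ∀ x, Ψ (-x) = Ψ x)
    (hconv : ∀ x y a b, 0 ≤ a → 0 ≤ b → a + b = 1 → Ψ (a • x + b • y) ≤ a * Ψ x + b * Ψ y)
    (hlip : ∀ x y, Ψ x - Ψ y ≤ 2 * ‖x - y‖)
    (hlow : ∀ x, ‖x‖ ≤ Ψ x) (hup : ∀ x, Ψ x ≤ 2 * ‖x‖)
    (huc : ∀ ε > 0, ∃ δ > 0, ∀ x y, ‖x‖ ≤ 1 → ‖y‖ ≤ 1 → ε ≤ ‖x - y‖ →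
      Ψ ((1 / 2 : ℝ) • (x + y)) ≤ (Ψ x + Ψ y) / 2 - δ) : HasEquivUnifConvexNorm X := by
  let K : Set X := {x | Ψ x ≤ 1}
  have hK0 : (0 : X) ∈ K := by
    show Ψ 0 ≤ 1
    have := hup 0
    simp at this; linarith
  have hKc : Convex ℝ K := by
    intro x hx y hy a b ha hb hab
    show Ψ _ ≤ 1
    have h1 : Ψ x ≤ 1 := hx
    have h2 : Ψ y ≤ 1 := hy
    refine (hconv x y a b ha hb hab).trans ?_
    calc a * Ψ x + b * Ψ y ≤ a * 1 + b * 1 := by gcongr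
      _ = 1 := by linarith
  have hKs : ∀ x ∈ K, -x ∈ K := by
    intro x hx
    show Ψ (-x) ≤ 1
    rw [hneg]; exact hx
  have hΨcont : Continuous Ψ := by
    have : LipschitzWith 2 Ψ := LipschitzWith.of_dist_le_mul fun x y => by
      rw [Real.dist_eq, abs_sub_le_iff, dist_eq_norm]
      refine ⟨hlip x y, ?_⟩
      rw [norm_sub_rev]; exact hlip y x
    exact this.continuous
  have hKcl : IsClosed K := isClosed_le hΨcont continuous_const
  have hball : Metric.ball (0 : X) (1 / 2) ⊆ K := by
    intro x hx
    show Ψ x ≤ 1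
    have := hup x
    simp at hx; linarith
  have hKb : K ⊆ Metric.closedBall 0 1 := by
    intro x hx
    have h1 : Ψ x ≤ 1 := hx
    simpa using (hlow x).trans h1
  have hKn : K ∈ nhds (0 : X) := Filter.mem_of_superset (Metric.ball_mem_nhds _ (by norm_num)) hball
  have habs : Absorbent ℝ K := absorbent_nhds_zero hKn
  have hmem : ∀ x, gauge K x ≤ 1 ↔ x ∈ K := by
    intro x
    rw [gauge_le_one_iff_mem_closure hKc hKn, hKcl.closure_eq]
  have hlowN : ∀ x, ‖x‖ ≤ gauge K x := by
    intro x
    have := le_gauge_of_subset_closedBall habs zero_le_one hKb (x := x)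
    simpa using this
  have hupN : ∀ x, gauge K x ≤ 2 * ‖x‖ := by
    intro x
    have := mul_gauge_le_norm (r := 1 / 2) hball (x := x)
    linarith
  have hsm : ∀ (c : ℝ) (x : X), gauge K (c • x) = |c| * gauge K x := by
    intro c x
    rcases le_total 0 c with hc | hc
    · rw [gauge_smul_of_nonneg hc, abs_of_nonneg hc, smul_eq_mul]
    · rw [← gauge_neg hKs, ← neg_smul, gauge_smul_of_nonneg (by linarith), abs_of_nonpos hc,
        smul_eq_mul]
  refine ⟨gauge K, ?_, hsm, gauge_add_le hKc habs, ⟨1, one_pos, 2, two_pos, fun x =>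
    ⟨by simpa using hlowN x, hupN x⟩⟩, ?_⟩
  · intro x
    constructor
    · intro h
      have := hlowN x
      rw [h] at this
      simpa using this
    · rintro rfl; exact gauge_zero
  · intro ε hε
    obtain ⟨δ, hδ, h⟩ := huc (ε / 2) (by linarith)
    refine ⟨2 - 2 / (1 + δ / 2), ?_, ?_⟩
    · have : 2 / (1 + δ / 2) < 2 := by rw [div_lt_iff₀ (by linarith)]; linarith
      linarith
    intro x y hx hy hxy
    have h1 : Ψ x ≤ 1 := (hmem x).1 hx
    have h2 : Ψ y ≤ 1 := (hmem y).1 hy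
    have hx1 := (hlow x).trans h1
    have hy1 := (hlow y).trans h2
    have h3 := h x y hx1 hy1 (by linarith [hupN (x - y)])
    set m := (1 / 2 : ℝ) • (x + y) with hm
    have hmn : ‖m‖ ≤ 1 := by
      have := hlow m
      linarith
    have h4 : Ψ ((1 + δ / 2) • m) ≤ 1 := by
      have := hlip ((1 + δ / 2) • m) m
      have e : (1 + δ / 2) • m - m = (δ / 2) • m := by rw [add_smul, one_smul]; abel
      rw [e, norm_smul, Real.norm_of_nonneg (by linarith)] at this
      nlinarith
    have h5 := (hmem _).2 h4
    have e : x + y = (2 / (1 + δ / 2)) • ((1 + δ / 2) • m) := by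
      rw [hm, smul_smul, smul_smul]
      have : 2 / (1 + δ / 2) * ((1 + δ / 2) * (1 / 2)) = 1 := by
        have : (1 + δ / 2) ≠ 0 := by linarith
        field_simp
      rw [mul_assoc, this, one_smul]
    have hp : 0 ≤ 2 / (1 + δ / 2) := by positivity
    rw [e, hsm, abs_of_nonneg hp]
    nlinarith

theorem UCAt.le_norm {ε : ℝ} {Φ : X → ℝ} (h : UCAt ε Φ) (x : X) : Φ x ≤ ‖x‖ := by
  have := h.lip x 0
  rw [h.zero] at this; simpa using this

theorem renorm (h : ∀ ε > 0, ∃ n, Der X ε n = ∅) : HasEquivUnifConvexNorm X := by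
  have h1 : ∀ j : ℕ, ∃ Φ : X → ℝ, UCAt (1 / ((j : ℝ) + 1)) Φ := fun j =>
    exists_UCAt _ (by positivity) (h _ (by positivity))
  choose Φ hΦ using h1
  let c : ℕ → ℝ := fun j => (1 / 2 : ℝ) ^ (j + 1)
  have hc0 : ∀ j, 0 < c j := fun j => by positivity
  have hcs : HasSum c 1 := by
    have := (hasSum_geometric_two).mul_left (1 / 2)
    have e : c = fun i => 1 / 2 * (1 / 2 : ℝ) ^ i := by
      funext j; simp only [c, pow_succ]; ring
    rw [e]
    norm_num at this ⊢
    exact this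
  have hs : ∀ x, Summable fun j => c j * Φ j x := fun x =>
    Summable.of_nonneg_of_le (fun j => mul_nonneg (hc0 j).le ((hΦ j).nonneg x))
      (fun j => mul_le_mul_of_nonneg_left ((hΦ j).le_norm x) (hc0 j).le)
      (hcs.summable.mul_right ‖x‖)
  apply renorm_of_Psi (fun x => ‖x‖ + ∑' j, c j * Φ j x)
  · intro x
    simp [(hΦ _).neg]
  · intro x y a b ha hb hab
    have e : a * (‖x‖ + ∑' j, c j * Φ j x) + b * (‖y‖ + ∑' j, c j * Φ j y) =
        (a * ‖x‖ + b * ‖y‖) + ∑' j, (a * (c j * Φ j x) + b * (c j * Φ j y)) := by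
      rw [((hs x).mul_left a).tsum_add ((hs y).mul_left b), tsum_mul_left, tsum_mul_left]
      ring
    rw [e]
    refine add_le_add ?_ ?_
    · refine (norm_add_le _ _).trans ?_
      rw [norm_smul, norm_smul, Real.norm_of_nonneg ha, Real.norm_of_nonneg hb]
    · refine (hs _).tsum_le_tsum (fun j => ?_) (((hs x).mul_left a).add ((hs y).mul_left b))
      have := mul_le_mul_of_nonneg_left ((hΦ j).conv x y a b ha hb hab) (hc0 j).le
      linarith
  · intro x y
    have : ∑' j, c j * Φ j x - ∑' j, c j * Φ j y ≤ ‖x - y‖ := by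
      rw [← (hs x).tsum_sub (hs y)]
      have e : ‖x - y‖ = ∑' j, c j * ‖x - y‖ := by rw [tsum_mul_right, hcs.tsum_eq, one_mul]
      rw [e]
      refine ((hs x).sub (hs y)).tsum_le_tsum (fun j => ?_) (hcs.summable.mul_right _)
      have := mul_le_mul_of_nonneg_left ((hΦ j).lip x y) (hc0 j).le
      linarith
    have h2 := norm_sub_norm_le x y
    linarith
  · intro x
    have : 0 ≤ ∑' j, c j * Φ j x := tsum_nonneg fun j => mul_nonneg (hc0 j).le ((hΦ j).nonneg x)
    linarith
  · intro x
    have : ∑' j, c j * Φ j x ≤ ∑' j, c j * ‖x‖ := (hs x).tsum_le_tsum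
      (fun j => mul_le_mul_of_nonneg_left ((hΦ j).le_norm x) (hc0 j).le)
      (hcs.summable.mul_right ‖x‖)
    rw [tsum_mul_right, hcs.tsum_eq, one_mul] at this
    linarith
  · intro ε hε
    obtain ⟨i, hi⟩ := exists_nat_one_div_lt (show 0 < ε / 4 by linarith)
    obtain ⟨δ, hδ, huc⟩ := (hΦ i).uc
    refine ⟨c i * δ, mul_pos (hc0 i) hδ, ?_⟩
    intro x y hx hy hxy
    have h1 := huc x y hx hy (by linarith)
    have h2 : ‖(1 / 2 : ℝ) • (x + y)‖ ≤ (‖x‖ + ‖y‖) / 2 := by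
      rw [norm_smul, Real.norm_of_nonneg (by norm_num)]
      have := norm_add_le x y
      linarith
    have hs3 : Summable fun j => if j = i then c i * δ else 0 :=
      (hasSum_ite_eq i (c i * δ)).summable
    have hs4 := (((hs x).add (hs y)).div_const 2).sub hs3
    have h3 : ∑' j, c j * Φ j ((1 / 2 : ℝ) • (x + y)) ≤
        ∑' j, ((c j * Φ j x + c j * Φ j y) / 2 - if j = i then c i * δ else 0) := by
      refine (hs _).tsum_le_tsum (fun j => ?_) hs4
      split_ifs with hji
      · subst hji
        have := mul_le_mul_of_nonneg_left h1 (hc0 j).le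
        linarith
      · have := (hΦ j).conv x y (1 / 2) (1 / 2) (by norm_num) (by norm_num) (by norm_num)
        rw [← smul_add] at this
        have := mul_le_mul_of_nonneg_left this (hc0 j).le
        linarith
    rw [(((hs x).add (hs y)).div_const 2).tsum_sub hs3, tsum_ite_eq, tsum_div_const,
      (hs x).tsum_add (hs y)] at h3
    linarith

theorem exists_Der_nonempty (h : ¬ HasEquivUnifConvexNorm X) :
    ∃ ε > 0, ∀ n, (Der X ε n).Nonempty := by
  by_contra! hcon
  exact h (renorm hcon)

end Renorm2
end LampAux

namespace LampAux
section Bush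
variable {X : Type*} [NormedAddCommGroup X] [NormedSpace ℝ X]

theorem Der_norm_le (ε : ℝ) (k : ℕ) : ∀ x ∈ Der X ε k, ‖x‖ ≤ 1 := by
  induction k with
  | zero => intro x hx; simpa [Der] using hx
  | succ k ih =>
    rintro x ⟨ι, _, w, y, hw, hw1, hy, rfl, hε⟩
    calc _ ≤ ∑ i, ‖w i • y i‖ := norm_sum_le _ _
      _ ≤ ∑ i, w i := Finset.sum_le_sum fun i _ => by
          rw [norm_smul, Real.norm_of_nonneg (hw i)]
          exact mul_le_of_le_one_right (hw i) (ih _ (hy i))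
      _ = 1 := hw1

theorem bush (ε : ℝ) (n : ℕ) : ∀ x ∈ Der X ε n,
    ∃ (Ω : Type) (_ : Fintype Ω) (w : Ω → ℝ) (M : ℕ → Ω → X),
      (∀ ω, 0 ≤ w ω) ∧ ∑ ω, w ω = 1 ∧ (∀ i < n, ∀ ω, ‖M i ω‖ ≤ 1) ∧
      (∀ (a : ℕ → ℝ) (c : X), ‖c + (∑ i ∈ Finset.range n, a i) • x‖ ≤
        ∑ ω, w ω * ‖c + ∑ i ∈ Finset.range n, a i • M i ω‖) ∧
      (∀ (a : ℕ → ℝ) (c : X) (j : ℕ), j < n → ε * |∑ i ∈ Finset.Ico j n, a i| ≤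
        ∑ ω, w ω * ‖c + ∑ i ∈ Finset.range n, a i • M i ω‖) := by
  induction n with
  | zero =>
    intro x hx
    exact ⟨Unit, inferInstance, fun _ => 1, fun _ _ => 0, by simp, by simp, by simp, by simp,
      by simp⟩
  | succ n ih =>
    rintro x ⟨ι, _, w, y, hw, hw1, hy, rfl, hε⟩
    have ih' := fun i => ih (y i) (hy i)
    choose Ω hΩ v M hv hv1 hM hJ hL using ih'
    let N : ℕ → (Σ i, Ω i) → X := fun k p => Nat.casesOn k (y p.1) (fun k => M p.1 k p.2)
    have key : ∀ (a : ℕ → ℝ) (c : X), ∑ p : (Σ i, Ω i), (w p.1 * v p.1 p.2) *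
        ‖c + ∑ i ∈ Finset.range (n + 1), a i • N i p‖ =
        ∑ i, w i * ∑ ω, v i ω * ‖(c + a 0 • y i) + ∑ k ∈ Finset.range n, a (k + 1) • M i k ω‖ := by
      intro a c
      rw [Fintype.sum_sigma]
      refine Finset.sum_congr rfl fun i _ => ?_
      rw [Finset.mul_sum]
      refine Finset.sum_congr rfl fun ω _ => ?_
      rw [Finset.sum_range_succ', mul_assoc]
      congr 3
      simp only [N]
      abel
    have key2 : ∀ (a : ℕ → ℝ) (c : X),
        ∑ i, w i * ‖c + (∑ k ∈ Finset.range (n + 1), a k) • y i‖ ≤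
        ∑ i, w i * ∑ ω, v i ω * ‖(c + a 0 • y i) + ∑ k ∈ Finset.range n, a (k + 1) • M i k ω‖ := by
      intro a c
      refine Finset.sum_le_sum fun i _ => mul_le_mul_of_nonneg_left ?_ (hw i)
      refine le_trans (le_of_eq ?_) (hJ i (fun k => a (k + 1)) (c + a 0 • y i))
      rw [Finset.sum_range_succ', add_smul]
      congr 1
      abel
    refine ⟨Σ i, Ω i, inferInstance, fun p => w p.1 * v p.1 p.2, N, ?_, ?_, ?_, ?_, ?_⟩
    · exact fun p => mul_nonneg (hw _) (hv _ _)
    · rw [Fintype.sum_sigma]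
      simp [← Finset.mul_sum, hv1, hw1]
    · rintro (_ | k) hk p
      · exact Der_norm_le ε n _ (hy _)
      · exact hM p.1 k (by omega) p.2
    · intro a c
      rw [key]
      refine le_trans ?_ (key2 a c)
      set s := ∑ k ∈ Finset.range (n + 1), a k
      have e : c + s • ∑ i, w i • y i = ∑ i, w i • (c + s • y i) := by
        simp only [smul_add, Finset.sum_add_distrib, ← Finset.sum_smul, hw1, one_smul,
          Finset.smul_sum, smul_comm s]
      rw [e]
      refine (norm_sum_le _ _).trans (le_of_eq ?_)
      refine Finset.sum_congr rfl fun i _ => ?_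
      rw [norm_smul, Real.norm_of_nonneg (hw i)]
    · intro a c j hj
      rw [key]
      rcases j with _ | j
      · refine le_trans ?_ (key2 a c)
        rw [← Finset.range_eq_Ico]
        set s := ∑ k ∈ Finset.range (n + 1), a k
        by_cases hs : s = 0
        · rw [hs, abs_zero, mul_zero]
          exact Finset.sum_nonneg fun i _ => mul_nonneg (hw i) (norm_nonneg _)
        · have h1 := mul_le_mul_of_nonneg_right (hε (-(s⁻¹ • c))) (abs_nonneg s)
          refine h1.trans (le_of_eq ?_)
          rw [Finset.sum_mul]
          refine Finset.sum_congr rfl fun i _ => ?_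
          rw [mul_assoc, ← Real.norm_eq_abs, mul_comm ‖_‖ ‖s‖, ← norm_smul]
          congr 2
          rw [sub_neg_eq_add, smul_add, smul_smul, mul_inv_cancel₀ hs, one_smul, add_comm]
      · have e : ∑ i ∈ Finset.Ico (j + 1) (n + 1), a i = ∑ i ∈ Finset.Ico j n, a (i + 1) := by
          rw [Finset.sum_Ico_add' (fun i => a i) j n 1]
        rw [e]
        set s := ∑ i ∈ Finset.Ico j n, a (i + 1)
        calc ε * |s| = ∑ i, w i * (ε * |s|) := by rw [← Finset.sum_mul, hw1, one_mul]
          _ ≤ _ := Finset.sum_le_sum fun i _ => mul_le_mul_of_nonneg_left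
              (hL i (fun k => a (k + 1)) _ j (by omega)) (hw i)

theorem bush_L2 (ε : ℝ) (hε : 0 < ε) (n : ℕ) (h : (Der X ε n).Nonempty) :
    ∃ (Ω : Type) (_ : Fintype Ω) (z : ℕ → PiLp 2 (fun _ : Ω => X)),
      (∀ i < n, ‖z i‖ ≤ 1) ∧ ∀ (a : ℕ → ℝ) (j : ℕ), 
        ε * |∑ i ∈ Finset.Ico j n, a i| ≤ ‖∑ i ∈ Finset.range n, a i • z i‖ := by
  obtain ⟨x, hx⟩ := h
  obtain ⟨Ω, _, w, M, hw, hw1, hM, -, hL⟩ := bush ε n x hx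
  refine ⟨Ω, inferInstance, fun i => WithLp.toLp 2 fun ω => √(w ω) • M i ω, ?_, ?_⟩
  · intro i hi
    rw [PiLp.norm_eq_of_L2]
    apply Real.sqrt_le_iff.2
    refine ⟨zero_le_one, ?_⟩
    rw [one_pow]
    refine le_trans (Finset.sum_le_sum fun ω _ => ?_) hw1.le
    simp only [norm_smul, mul_pow, Real.norm_eq_abs, sq_abs, Real.sq_sqrt (hw ω)]
    have := hM i hi ω
    exact mul_le_of_le_one_right (hw ω) (by nlinarith [norm_nonneg (M i ω)])
  · intro a j
    rcases lt_or_ge j n with hj | hj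
    swap
    · rw [Finset.Ico_eq_empty (by omega)]; simp
    have h1 := hL a 0 j hj
    refine h1.trans ?_
    simp only [zero_add]
    rw [PiLp.norm_eq_of_L2]
    apply Real.le_sqrt_of_sq_le
    set F : Ω → ℝ := fun ω => ‖∑ i ∈ Finset.range n, a i • M i ω‖ with hF
    have e : ∀ ω, ‖(∑ i ∈ Finset.range n, a i • WithLp.toLp 2 fun ω => √(w ω) • M i ω :
        PiLp 2 (fun _ : Ω => X)) ω‖ ^ 2 = w ω * F ω ^ 2 := by
      intro ω
      have : (∑ i ∈ Finset.range n, a i • WithLp.toLp 2 fun ω => √(w ω) • M i ω :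
        PiLp 2 (fun _ : Ω => X)) ω = √(w ω) • ∑ i ∈ Finset.range n, a i • M i ω := by
        rw [WithLp.ofLp_sum, Finset.sum_apply, Finset.smul_sum]
        refine Finset.sum_congr rfl fun i _ => ?_
        exact smul_comm _ _ _
      rw [this, norm_smul, mul_pow, Real.norm_eq_abs, sq_abs, Real.sq_sqrt (hw ω)]
    rw [Finset.sum_congr rfl fun ω _ => e ω]
    have cs := Finset.sum_mul_sq_le_sq_mul_sq Finset.univ (fun ω => √(w ω)) (fun ω => √(w ω) * F ω)
    calc _ = (∑ ω, √(w ω) * (√(w ω) * F ω)) ^ 2 := by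
          congr 1
          refine Finset.sum_congr rfl fun ω _ => ?_
          rw [← mul_assoc, Real.mul_self_sqrt (hw ω)]
      _ ≤ _ := cs
      _ = _ := by simp only [mul_pow, Real.sq_sqrt (hw _), hw1, one_mul]

end Bush
end LampAux

namespace LampAux
section Spread
open Filter Topology

/-- Limit along a fixed nonprincipal ultrafilter. -/
noncomputable def ulim (s : ℕ → ℝ) : ℝ := limUnder (hyperfilter ℕ : Filter ℕ) s

theorem tendsto_ulim (s : ℕ → ℝ) (B : ℝ) (h : ∀ n, |s n| ≤ B) :
    Tendsto s (hyperfilter ℕ : Filter ℕ) (𝓝 (ulim s)) := by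
  apply tendsto_nhds_limUnder
  obtain ⟨l, -, hl⟩ := (isCompact_Icc (a := -B) (b := B)).ultrafilter_le_nhds
    ((hyperfilter ℕ).map s) (by
      rw [le_principal_iff]
      exact Filter.mem_map.2 (Filter.univ_mem' fun n => abs_le.1 (h n)))
  exact ⟨l, hl⟩

theorem ulim_const (c : ℝ) : ulim (fun _ => c) = c :=
  tendsto_nhds_unique (tendsto_ulim _ |c| fun _ => le_rfl) tendsto_const_nhds

theorem eventually_hyper_of_le (i0 : ℕ) (P : ℕ → Prop) (h : ∀ i, i0 ≤ i → P i) :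
    ∀ᶠ i in (hyperfilter ℕ : Filter ℕ), P i := by
  apply Filter.hyperfilter_le_cofinite
  rw [Nat.cofinite_eq_atTop]
  exact eventually_atTop.2 ⟨i0, h⟩

abbrev VV := ℕ →₀ ℝ

noncomputable def ee (i : ℕ) : VV := Finsupp.single i 1

/-- Iterated limits. -/
noncomputable def GG (p : Seminorm ℝ VV) : List ℝ → VV → ℝ
  | [], x => p x
  | a :: l, x => ulim fun i => GG p l (x + a • ee i)

variable (p : Seminorm ℝ VV)

theorem GG_bounds (hp : ∀ i, p (ee i) ≤ 1) (l : List ℝ) : ∀ x, 0 ≤ GG p l x ∧ GG p l x ≤ p x + (l.map abs).sum := by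
  induction l with
  | nil => intro x; simp [GG]
  | cons a l ih =>
    intro x
    have hb : ∀ i, 0 ≤ GG p l (x + a • ee i) ∧
        GG p l (x + a • ee i) ≤ p x + ((a :: l).map abs).sum := by
      intro i
      refine ⟨(ih _).1, (ih _).2.trans ?_⟩
      have h1 : p (x + a • ee i) ≤ p x + p (a • ee i) := map_add_le_add p _ _
      rw [map_smul_eq_mul, Real.norm_eq_abs] at h1
      have := mul_le_of_le_one_right (abs_nonneg a) (hp i)
      simp only [List.map_cons, List.sum_cons]
      linarith
    have ht := tendsto_ulim (fun i => GG p l (x + a • ee i)) _ fun i => by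
      rw [abs_of_nonneg (hb i).1]; exact (hb i).2
    exact ⟨ge_of_tendsto' ht fun i => (hb i).1, le_of_tendsto' ht fun i => (hb i).2⟩

theorem GG_tendsto (hp : ∀ i, p (ee i) ≤ 1) (a : ℝ) (l : List ℝ) (x : VV) :
    Tendsto (fun i => GG p l (x + a • ee i)) (hyperfilter ℕ : Filter ℕ) (𝓝 (GG p (a :: l) x)) := by
  refine tendsto_ulim (fun i => GG p l (x + a • ee i)) (p x + |a| + (l.map abs).sum) fun i => ?_
  rw [abs_of_nonneg (GG_bounds p hp l _).1]
  refine (GG_bounds p hp l _).2.trans ?_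
  have h1 : p (x + a • ee i) ≤ p x + p (a • ee i) := map_add_le_add p _ _
  rw [map_smul_eq_mul, Real.norm_eq_abs] at h1
  have := mul_le_of_le_one_right (abs_nonneg a) (hp i)
  linarith

theorem GG_filter (l : List ℝ) : ∀ x, GG p l x = GG p (l.filter (fun a => decide (a ≠ 0))) x := by
  induction l with
  | nil => intro x; simp
  | cons a l ih =>
    intro x
    by_cases ha : a = 0
    · subst ha
      simp only [GG, zero_smul, add_zero, ulim_const]
      rw [ih x]
      simp
    · rw [List.filter_cons_of_pos (by simpa using ha)]
      simp only [GG]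
      congr 1
      funext i
      exact ih _

theorem GG_add (hp : ∀ i, p (ee i) ≤ 1) (L : List ℕ) (f g : ℕ → ℝ) : ∀ x y,
    GG p (L.map (fun k => f k + g k)) (x + y) ≤ GG p (L.map f) x + GG p (L.map g) y := by
  induction L with
  | nil => intro x y; simpa [GG] using map_add_le_add p x y
  | cons k L ih =>
    intro x y
    simp only [List.map_cons]
    refine le_of_tendsto_of_tendsto' (GG_tendsto p hp _ _ _)
      ((GG_tendsto p hp _ _ _).add (GG_tendsto p hp _ _ _)) fun i => ?_
    have := ih (x + f k • ee i) (y + g k • ee i)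
    rwa [show x + f k • ee i + (y + g k • ee i) = x + y + (f k + g k) • ee i by
      rw [add_smul]; abel] at this

theorem GG_smul (hp : ∀ i, p (ee i) ≤ 1) (L : List ℕ) (f : ℕ → ℝ) (c : ℝ) : ∀ x,
    GG p (L.map (fun k => c * f k)) (c • x) = |c| * GG p (L.map f) x := by
  induction L with
  | nil => intro x; simp [GG, map_smul_eq_mul]
  | cons k L ih =>
    intro x
    simp only [List.map_cons]
    refine tendsto_nhds_unique (GG_tendsto p hp _ _ _)
      (((GG_tendsto p hp _ _ _).const_mul |c|).congr fun i => ?_)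
    rw [← ih (x + f k • ee i), smul_add, smul_smul]

theorem GG_low_all (hp : ∀ i, p (ee i) ≤ 1) (τ : ℕ → VV →ₗ[ℝ] ℝ) (ε : ℝ) (hτ : ∀ i0 x, ε * |τ i0 x| ≤ p x)
    (hτe : ∀ i0 i, i0 ≤ i → τ i0 (ee i) = 1) (l : List ℝ) : ∀ i0 x,
    ε * |τ i0 x + l.sum| ≤ GG p l x := by
  induction l with
  | nil => intro i0 x; simpa [GG] using hτ i0 x
  | cons a l ih =>
    intro i0 x
    refine ge_of_tendsto (GG_tendsto p hp _ _ _) (eventually_hyper_of_le i0 _ fun i hi => ?_)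
    have := ih i0 (x + a • ee i)
    rw [map_add, map_smul, hτe _ _ hi, smul_eq_mul, mul_one, add_assoc] at this
    simpa using this

theorem GG_low (hp : ∀ i, p (ee i) ≤ 1) (τ : ℕ → VV →ₗ[ℝ] ℝ) (ε : ℝ) (hτ : ∀ i0 x, ε * |τ i0 x| ≤ p x)
    (hτe : ∀ i0 i, i0 ≤ i → τ i0 (ee i) = 1) (hτ0 : ∀ x, ∃ i0, τ i0 x = 0) (l : List ℝ) :
    ∀ j x, ε * |(l.drop j).sum| ≤ GG p l x := by
  induction l with
  | nil => intro j x; simp [GG]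
  | cons a l ih =>
    intro j x
    rcases j with _ | j
    · obtain ⟨i0, hi0⟩ := hτ0 x
      have := GG_low_all p hp τ ε hτ hτe (a :: l) i0 x
      rw [hi0, zero_add] at this
      simpa using this
    · exact ge_of_tendsto' (GG_tendsto p hp _ _ _) fun i => by simpa using ih j _

theorem GG_pull (hp : ∀ i, p (ee i) ≤ 1) {Θ : Type*} [Finite Θ] (a : Θ → ℕ → ℝ) (L : List ℕ) : ∀ (x : Θ → VV) (δ : ℝ), 0 < δ →
    ∃ T : (ℕ → ℝ) →ₗ[ℝ] VV, ∀ θ, |GG p (L.map (a θ)) (x θ) - p (x θ + T (a θ))| < δ := by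
  induction L with
  | nil => intro x δ hδ; exact ⟨0, fun θ => by simpa [GG] using hδ⟩
  | cons k L ih =>
    intro x δ hδ
    have h1 : ∀ θ, ∀ᶠ i in (hyperfilter ℕ : Filter ℕ),
        |GG p (L.map (a θ)) (x θ + a θ k • ee i) - GG p ((k :: L).map (a θ)) (x θ)| < δ / 2 := by
      intro θ
      have := (GG_tendsto p hp (a θ k) (L.map (a θ)) (x θ)).eventually
        (Metric.ball_mem_nhds _ (half_pos hδ))
      exact this
    obtain ⟨i, hi⟩ := (eventually_all.2 h1).exists
    obtain ⟨T, hT⟩ := ih (fun θ => x θ + a θ k • ee i) (δ / 2) (half_pos hδ)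
    refine ⟨T + (LinearMap.proj k : (ℕ → ℝ) →ₗ[ℝ] ℝ).smulRight (ee i), fun θ => ?_⟩
    have h2 := hT θ
    have h3 := hi θ
    have e : x θ + (T + (LinearMap.proj k : (ℕ → ℝ) →ₗ[ℝ] ℝ).smulRight (ee i)) (a θ) =
        x θ + a θ k • ee i + T (a θ) := by
      simp; abel
    rw [e]
    rw [abs_lt] at *
    constructor <;> linarith
end Spread

section Spread2
open Filter Topology

/-- Abstract spreading model of bushes, with finite representability data. -/
theorem exists_spread {Y : ℕ → Type*} [∀ n, NormedAddCommGroup (Y n)] [∀ n, NormedSpace ℝ (Y n)]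
    (z : ∀ n, ℕ → Y n) (ε : ℝ)
    (hz : ∀ n, ∀ i < n, ‖z n i‖ ≤ 1)
    (hlow : ∀ n (a : ℕ → ℝ) (j : ℕ), ε * |∑ i ∈ Finset.Ico j n, a i| ≤
      ‖∑ i ∈ Finset.range n, a i • z n i‖) :
    ∃ G : List ℝ → ℝ,
      (∀ l, 0 ≤ G l ∧ G l ≤ (l.map abs).sum) ∧
      (∀ l, G l = G (l.filter (fun a => decide (a ≠ 0)))) ∧
      (∀ (L : List ℕ) (f g : ℕ → ℝ), G (L.map fun k => f k + g k) ≤ G (L.map f) + G (L.map g)) ∧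
      (∀ (L : List ℕ) (f : ℕ → ℝ) (c : ℝ), G (L.map fun k => c * f k) = |c| * G (L.map f)) ∧
      (∀ (l : List ℝ) (j : ℕ), ε * |(l.drop j).sum| ≤ G l) ∧
      (∀ (L : List ℕ) (m : ℕ) (a : Fin m → ℕ → ℝ) (δ : ℝ), 0 < δ →
        ∃ (n : ℕ) (T : (ℕ → ℝ) →ₗ[ℝ] Y n), ∀ θ, |G (L.map (a θ)) - ‖T (a θ)‖| < δ) := by
  let Z : ∀ n, ℕ → Y n := fun n i => if i < n then z n i else 0
  have hZ : ∀ n i, ‖Z n i‖ ≤ 1 := by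
    intro n i
    simp only [Z]
    split_ifs with h
    · exact hz n i h
    · simp
  let S : ∀ n, VV →ₗ[ℝ] Y n := fun n => Finsupp.linearCombination ℝ (Z n)
  have hS : ∀ n x, ‖S n x‖ ≤ x.sum fun _ c => |c| := by
    intro n x
    simp only [S, Finsupp.linearCombination_apply, Finsupp.sum]
    refine (norm_sum_le _ _).trans (Finset.sum_le_sum fun i _ => ?_)
    rw [norm_smul, Real.norm_eq_abs]
    exact mul_le_of_le_one_right (abs_nonneg _) (hZ n i)
  have hN : ∀ x, Tendsto (fun n => ‖S n x‖) (hyperfilter ℕ : Filter ℕ)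
      (𝓝 (ulim fun n => ‖S n x‖)) := fun x => tendsto_ulim _ _ fun n => by
    rw [abs_of_nonneg (norm_nonneg _)]; exact hS n x
  let p : Seminorm ℝ VV := Seminorm.of (fun x => ulim fun n => ‖S n x‖)
    (fun x y => le_of_tendsto_of_tendsto' (hN _) ((hN x).add (hN y)) fun n => by
      rw [map_add]; exact norm_add_le _ _)
    (fun c x => tendsto_nhds_unique (hN _) (((hN x).const_mul ‖c‖).congr fun n => by
      rw [map_smul, norm_smul]))
  have hpt : ∀ x, Tendsto (fun n => ‖S n x‖) (hyperfilter ℕ : Filter ℕ) (𝓝 (p x)) := hN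
  have hp : ∀ i, p (ee i) ≤ 1 := fun i => le_of_tendsto' (hpt _) fun n => by
    simpa [S, ee] using hZ n i
  let τ : ℕ → VV →ₗ[ℝ] ℝ := fun i0 => Finsupp.linearCombination ℝ fun i => if i0 ≤ i then 1 else 0
  have hτe : ∀ i0 i, i0 ≤ i → τ i0 (ee i) = 1 := by
    intro i0 i h
    simp [τ, ee, h]
  have hsupp : ∀ x : VV, ∃ N, ∀ i, N ≤ i → x i = 0 := by
    intro x
    refine ⟨x.support.sup id + 1, fun i hi => ?_⟩
    by_contra h
    have : i ≤ x.support.sup id := Finset.le_sup (f := id) (Finsupp.mem_support_iff.2 h)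
    omega
  have hτ0 : ∀ x, ∃ i0, τ i0 x = 0 := by
    intro x
    obtain ⟨N, hN⟩ := hsupp x
    refine ⟨N, ?_⟩
    simp only [τ, Finsupp.linearCombination_apply, Finsupp.sum]
    refine Finset.sum_eq_zero fun i hi => ?_
    rw [if_neg, smul_zero]
    intro h
    exact Finsupp.mem_support_iff.1 hi (hN i h)
  have hτ : ∀ i0 x, ε * |τ i0 x| ≤ p x := by
    intro i0 x
    obtain ⟨N, hN⟩ := hsupp x
    refine ge_of_tendsto (hpt x) (eventually_hyper_of_le N _ fun n hn => ?_)
    have h1 := hlow n (fun i => x i) i0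
    have hsub : x.support ⊆ Finset.range n := by
      intro i hi
      rw [Finset.mem_range]
      by_contra h
      exact Finsupp.mem_support_iff.1 hi (hN i (by omega))
    have e1 : S n x = ∑ i ∈ Finset.range n, x i • z n i := by
      simp only [S, Finsupp.linearCombination_apply]
      rw [Finsupp.sum_of_support_subset _ hsub _ (by simp)]
      refine Finset.sum_congr rfl fun i hi => ?_
      simp [Z, Finset.mem_range.1 hi]
    have e2 : τ i0 x = ∑ i ∈ Finset.Ico i0 n, x i := by
      simp only [τ, Finsupp.linearCombination_apply]
      rw [Finsupp.sum_of_support_subset _ hsub _ (by simp)]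
      simp only [smul_eq_mul, mul_ite, mul_one, mul_zero]
      rw [← Finset.sum_filter]
      congr 1
      ext i
      simp [and_comm]
    rw [e1, e2]
    exact h1
  refine ⟨fun l => GG p l 0, ?_, ?_, ?_, ?_, ?_, ?_⟩
  · intro l
    have := GG_bounds p hp l 0
    simpa using this
  · exact fun l => GG_filter p l 0
  · intro L f g
    simpa using GG_add p hp L f g 0 0
  · intro L f c
    simpa using GG_smul p hp L f c 0
  · exact fun l j => GG_low p hp τ ε hτ hτe hτ0 l j 0
  · intro L m a δ hδ
    obtain ⟨T, hT⟩ := GG_pull p hp a L (fun _ => 0) (δ / 2) (half_pos hδ)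
    have h1 : ∀ θ, ∀ᶠ n in (hyperfilter ℕ : Filter ℕ), |‖S n (T (a θ))‖ - p (T (a θ))| < δ / 2 :=
      fun θ => (hpt (T (a θ))).eventually (Metric.ball_mem_nhds _ (half_pos hδ))
    obtain ⟨n, hn⟩ := (eventually_all.2 h1).exists
    refine ⟨n, (S n).comp T, fun θ => ?_⟩
    have h2 := hT θ
    have h3 := hn θ
    rw [zero_add] at h2
    rw [LinearMap.comp_apply]
    rw [abs_lt] at *
    constructor <;> linarith

end Spread2
end LampAux

namespace LampAux
section James

structure SpreadG (ε : ℝ) (G : List ℝ → ℝ) : Prop where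
  bounds : ∀ l, 0 ≤ G l ∧ G l ≤ (l.map abs).sum
  filt : ∀ l, G l = G (l.filter (fun a => decide (a ≠ 0)))
  smul : ∀ (L : List ℕ) (f : ℕ → ℝ) (c : ℝ), G (L.map fun k => c * f k) = |c| * G (L.map f)
  low : ∀ (l : List ℝ) (j : ℕ), ε * |(l.drop j).sum| ≤ G l

/-- The value on a function restricted to `[0,m)`. -/
def QQ (G : List ℝ → ℝ) (m : ℕ) (f : ℕ → ℝ) : ℝ := G ((List.range m).map f)

variable {ε : ℝ} {G : List ℝ → ℝ}

theorem SpreadG.spread (hG : SpreadG ε G) (a : ℕ → ℝ) (n M : ℕ) (φ : ℕ → ℕ) (hφ : StrictMono φ)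
    (ha : ∀ x, n ≤ x → a x = 0) (hM : ∀ x < n, φ x < M) :
    QQ G M (Function.extend φ a 0) = QQ G n a := by
  unfold QQ
  rw [hG.filt, hG.filt ((List.range n).map a)]
  congr 1
  rw [List.filter_map, List.filter_map]
  have hy : ∀ x, Function.extend φ a 0 (φ x) = a x := fun x => hφ.injective.extend_apply a 0 x
  have key : (List.range M).filter ((fun a => decide (a ≠ 0)) ∘ Function.extend φ a 0) =
      ((List.range n).filter ((fun a => decide (a ≠ 0)) ∘ a)).map φ := by
    have s1 : ((List.range M).filter
        ((fun a => decide (a ≠ 0)) ∘ Function.extend φ a 0)).SortedLT :=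
      List.Pairwise.sortedLT (List.Pairwise.filter _ List.pairwise_lt_range)
    have s2 : (((List.range n).filter ((fun a => decide (a ≠ 0)) ∘ a)).map φ).SortedLT := by
      apply List.Pairwise.sortedLT
      rw [List.pairwise_map]
      exact (List.Pairwise.filter _ List.pairwise_lt_range).imp fun h => hφ h
    refine List.SortedLT.eq_of_mem_iff s1 s2 fun q => ?_
    simp only [List.mem_filter, List.mem_range, List.mem_map, Function.comp_apply,
      decide_eq_true_eq]
    constructor
    · rintro ⟨hq, h⟩
      by_cases hex : ∃ x, φ x = q
      · obtain ⟨x, rfl⟩ := hex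
        rw [hy] at h
        refine ⟨x, ⟨?_, h⟩, rfl⟩
        by_contra hx
        exact h (ha x (by omega))
      · rw [Function.extend_apply' _ _ _ hex] at h
        exact absurd rfl h
    · rintro ⟨x, ⟨hx, h⟩, rfl⟩
      exact ⟨hM x hx, by rwa [hy]⟩
  rw [key, List.map_map]
  congr 1
  funext x
  exact hy x

theorem SpreadG.Qsmul (hG : SpreadG ε G) (m : ℕ) (f : ℕ → ℝ) (c : ℝ) :
    QQ G m (fun k => c * f k) = |c| * QQ G m f := hG.smul _ _ _

theorem list_drop_sum (m : ℕ) (f : ℕ → ℝ) (j : ℕ) :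
    (((List.range m).map f).drop j).sum = ∑ i ∈ Finset.Ico j m, f i := by
  induction m with
  | zero => simp
  | succ m ih =>
    rcases le_or_gt j m with h | h
    · rw [List.range_succ, List.map_append, List.drop_append_of_le_length (by simpa using h),
        List.sum_append, ih, Finset.sum_Ico_succ_top h]
      simp
    · rw [List.drop_eq_nil_of_le (by simp; omega), Finset.Ico_eq_empty (by omega)]
      simp

theorem SpreadG.Qlow (hG : SpreadG ε G) (m : ℕ) (f : ℕ → ℝ) (j : ℕ) :
    ε * |∑ i ∈ Finset.Ico j m, f i| ≤ QQ G m f := by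
  have h := hG.low ((List.range m).map f) j
  have e : ∑ i ∈ Finset.Ico j m, f i = (((List.range m).map f).drop j).sum := by
    exact (list_drop_sum m f j).symm
  rw [e]; exact h

theorem SpreadG.Qle (hG : SpreadG ε G) (m : ℕ) (f : ℕ → ℝ) :
    QQ G m f ≤ ∑ i ∈ Finset.range m, |f i| := by
  refine (hG.bounds _).2.trans (le_of_eq ?_)
  rw [List.map_map]
  have := list_drop_sum m (abs ∘ f) 0
  rw [List.drop_zero] at this
  rw [this, Finset.range_eq_Ico]
  rfl

/-- Values of alternating vectors. -/
def KK (G : List ℝ → ℝ) (r : ℕ) : Set ℝ :=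
  {v | ∃ (n : ℕ) (a : ℕ → ℝ) (j : ℕ → ℕ), (∀ l, l + 1 < r → j l < j (l + 1)) ∧
    (∀ x, n ≤ x → a x = 0) ∧
    (∀ l < r, ∑ x ∈ Finset.Ico (j l) n, a x = (-1) ^ l) ∧ v = QQ G n a}

theorem SpreadG.KK_low (hG : SpreadG ε G) (r : ℕ) : ∀ v ∈ KK G (r + 1), ε ≤ v := by
  rintro v ⟨n, a, j, -, -, h, rfl⟩
  have := hG.Qlow n a (j 0)
  rw [h 0 (by omega)] at this
  simpa using this

theorem SpreadG.KK_up (hG : SpreadG ε G) (r : ℕ) : ∃ v ∈ KK G r, v ≤ 2 * r := by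
  let t : ℕ → ℝ := fun l => if l < r then (-1) ^ l else 0
  have ht : ∀ l, |t l| ≤ 1 := by
    intro l
    simp only [t]
    split_ifs
    · simp
    · simp
  refine ⟨_, ⟨r, fun x => t x - t (x + 1), id, fun l _ => Nat.lt_succ_self l, ?_, ?_, rfl⟩, ?_⟩
  · intro x hx
    simp only [t]
    rw [if_neg (by omega), if_neg (by omega), sub_zero]
  · intro l hl
    have : ∀ m, l ≤ m → ∑ x ∈ Finset.Ico l m, (t x - t (x + 1)) = t l - t m := by
      intro m hm
      induction m, hm using Nat.le_induction with
      | base => simp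
      | succ m hm ih => rw [Finset.sum_Ico_succ_top hm, ih]; ring
    rw [id, this r hl.le]
    simp [t, hl]
  · refine (hG.Qle _ _).trans ?_
    calc _ ≤ ∑ i ∈ Finset.range r, (2 : ℝ) := Finset.sum_le_sum fun i _ => by
          have h1 := abs_le.1 (ht i)
          have h2 := abs_le.1 (ht (i + 1))
          rw [abs_le]; constructor <;> linarith
      _ = _ := by simp [mul_comm]

theorem SpreadG.exists_r (hG : SpreadG ε G) (hε : 0 < ε) (δ : ℝ) (hδ : 0 < δ) (hδ1 : δ < 1) :
    ∃ r, 0 < sInf (KK G (r + 1)) ∧ (∀ v ∈ KK G (r + 1), sInf (KK G (r + 1)) ≤ v) ∧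
      0 < sInf (KK G (r + 2)) ∧ (KK G (r + 2)).Nonempty ∧
      (1 - δ) * sInf (KK G (r + 2)) ≤ sInf (KK G (r + 1)) := by
  have hne : ∀ r, (KK G r).Nonempty := fun r => by
    obtain ⟨v, hv, -⟩ := hG.KK_up r
    exact ⟨v, hv⟩
  have hbdd : ∀ r, BddBelow (KK G (r + 1)) := fun r => ⟨ε, hG.KK_low r⟩
  have hge : ∀ r, ε ≤ sInf (KK G (r + 1)) := fun r => le_csInf (hne _) (hG.KK_low r)
  have hle : ∀ r, sInf (KK G (r + 1)) ≤ 2 * ((r + 1 : ℕ) : ℝ) := fun r => by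
    obtain ⟨v, hv, h⟩ := hG.KK_up (r + 1)
    exact (csInf_le (hbdd r) hv).trans h
  by_contra! hcon
  have hstep : ∀ r, sInf (KK G (r + 1)) < (1 - δ) * sInf (KK G (r + 2)) := fun r =>
    hcon r (hε.trans_le (hge r)) (fun v hv => csInf_le (hbdd r) hv) (hε.trans_le (hge (r + 1))) (hne _)
  have hpow : ∀ r, ε ≤ (1 - δ) ^ r * sInf (KK G (r + 1)) := by
    intro r
    induction r with
    | zero => simpa using hge 0
    | succ r ih =>
      refine ih.trans ?_
      rw [pow_succ, mul_assoc]
      exact mul_le_mul_of_nonneg_left (hstep r).le (pow_nonneg (by linarith) _)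
  have hlim : Filter.Tendsto (fun r : ℕ => ((r : ℝ) + 1) * (1 - δ) ^ r) Filter.atTop (nhds 0) := by
    have h1 := tendsto_self_mul_const_pow_of_lt_one (r := 1 - δ) (by linarith) (by linarith)
    have h2 := tendsto_pow_atTop_nhds_zero_of_lt_one (r := 1 - δ) (by linarith) (by linarith)
    have := h1.add h2
    rw [add_zero] at this
    refine this.congr fun r => by ring
  obtain ⟨r, hr⟩ := (hlim.eventually (gt_mem_nhds (show 0 < ε / 2 by linarith))).exists
  have h1 := hpow r
  have h2 := mul_le_mul_of_nonneg_left (hle r) (pow_nonneg (show 0 ≤ 1 - δ by linarith) r)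
  push_cast at h2
  linarith

theorem sum_extend (a : ℕ → ℝ) (n M T : ℕ) (φ : ℕ → ℕ) (hφ : StrictMono φ)
    (ha : ∀ x, n ≤ x → a x = 0) (hM : ∀ x < n, φ x < M) :
    ∑ q ∈ Finset.Ico T M, Function.extend φ a 0 q = ∑ x ∈ Finset.range n with T ≤ φ x, a x := by
  have hy : ∀ x, Function.extend φ a 0 (φ x) = a x := fun x => hφ.injective.extend_apply a 0 x
  rw [← Finset.sum_congr rfl fun x _ => hy x, ← Finset.sum_image (f := Function.extend φ a 0)
    (g := φ) fun x _ y _ h => hφ.injective h]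
  symm
  apply Finset.sum_subset
  · intro q hq
    simp only [Finset.mem_image, Finset.mem_filter, Finset.mem_range] at hq
    obtain ⟨x, ⟨hx, hT⟩, rfl⟩ := hq
    exact Finset.mem_Ico.2 ⟨hT, hM x hx⟩
  · intro q hq hq'
    by_cases hex : ∃ x, φ x = q
    · obtain ⟨x, rfl⟩ := hex
      rw [hy]
      apply ha
      by_contra hx
      apply hq'
      simp only [Finset.mem_image, Finset.mem_filter, Finset.mem_range]
      exact ⟨x, ⟨by omega, (Finset.mem_Ico.1 hq).1⟩, rfl⟩
    · rw [Function.extend_apply' _ _ _ hex]; rfl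


/-- James-type self-improvement. -/
theorem SpreadG.james (hG : SpreadG ε G) (hε : 0 < ε) (δ : ℝ) (hδ : 0 < δ) (hδ1 : δ < 1)
    (m : ℕ) (hm : 0 < m) : ∃ (M : ℕ) (y : ℕ → ℕ → ℝ), (∀ i < m, QQ G M (y i) ≤ 1) ∧
      ∀ k ≤ m, (m : ℝ) * (1 - δ) ≤
        QQ G M (fun q => ∑ i ∈ Finset.range m, (if k ≤ i then 1 else -1) * y i q) := by
  obtain ⟨r, hk1, hk1le, hk2, hk2ne, hkk⟩ := hG.exists_r hε (δ / 2) (by linarith) (by linarith)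
  set κ₁ := sInf (KK G (r + 1)) with hκ₁
  set κ₂ := sInf (KK G (r + 2)) with hκ₂
  obtain ⟨v, ⟨n, a, j, hj, ha, htail, rfl⟩, hv⟩ := exists_lt_of_csInf_lt hk2ne
    (show sInf (KK G (r + 2)) < (1 + δ / 2) * κ₂ by rw [← hκ₂]; nlinarith)
  have hn : 0 < n := by
    by_contra h0
    have h0 : n = 0 := by omega
    have := htail 0 (by omega)
    rw [h0] at this
    simp at this
  -- counting function
  let lev : ℕ → ℕ := fun x => ((Finset.range (r + 2)).filter fun l => j l ≤ x).card
  have hjm : ∀ l l', l < l' → l' < r + 2 → j l < j l' := by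
    intro l l' h
    induction l', h using Nat.le_induction with
    | base => intro h; exact hj l h
    | succ l' h ih => intro h2; exact (ih (by omega)).trans (hj l' h2)
  have hlev_mono : Monotone lev := fun x x' h => Finset.card_le_card fun l hl => by
    simp only [Finset.mem_filter] at hl ⊢
    exact ⟨hl.1, hl.2.trans h⟩
  have hlev_le : ∀ x, lev x ≤ r + 2 := fun x => (Finset.card_filter_le _ _).trans (by simp)
  have hlev_iff : ∀ l < r + 2, ∀ x, l + 1 ≤ lev x ↔ j l ≤ x := by
    intro l hl x
    constructor
    · intro h
      by_contra hx
      have : lev x ≤ l := by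
        calc lev x ≤ (Finset.range l).card := Finset.card_le_card fun l' hl' => by
              simp only [Finset.mem_filter, Finset.mem_range] at hl' ⊢
              by_contra hll
              rcases Nat.lt_or_ge l l' with h3 | h3
              · have := hjm l l' h3 hl'.1
                omega
              · have : l = l' := by omega
                subst this
                omega
          _ = l := by simp
      omega
    · intro h
      calc l + 1 = (Finset.range (l + 1)).card := by simp
        _ ≤ lev x := Finset.card_le_card fun l' hl' => by
              simp only [Finset.mem_filter, Finset.mem_range] at hl' ⊢
              refine ⟨by omega, ?_⟩
              rcases Nat.lt_or_ge l' l with h3 | h3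
              · exact (hjm l' l h3 hl).le.trans h
              · have : l' = l := by omega
                subst this; exact h
  let φ : ℕ → ℕ → ℕ := fun i x => (lev x * m + i) * n + x
  let M : ℕ := ((r + 2) * m + m) * n
  have hφ : ∀ i, StrictMono (φ i) := by
    intro i x x' h
    have h1 := hlev_mono h.le
    have : (lev x * m + i) * n ≤ (lev x' * m + i) * n := by gcongr
    show (lev x * m + i) * n + x < (lev x' * m + i) * n + x'
    omega
  have hM : ∀ i < m, ∀ x < n, φ i x < M := by
    intro i hi x hx
    have h1 : lev x * m + i + 1 ≤ (r + 2) * m + m := by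
      have := Nat.mul_le_mul_right m (hlev_le x)
      omega
    have h2 := Nat.mul_le_mul_right n h1
    show (lev x * m + i) * n + x < ((r + 2) * m + m) * n
    rw [add_mul _ 1 n] at h2
    omega
  let y : ℕ → ℕ → ℝ := fun i => Function.extend (φ i) a 0
  have hy0 : ∀ i < m, ∀ q, M ≤ q → y i q = 0 := by
    intro i hi q hq
    by_cases hex : ∃ x, φ i x = q
    · obtain ⟨x, rfl⟩ := hex
      show Function.extend (φ i) a 0 (φ i x) = 0
      rw [(hφ i).injective.extend_apply]
      apply ha
      by_contra hx
      have := hM i hi x (by omega)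
      omega
    · exact Function.extend_apply' _ _ _ hex
  have htl : ∀ i < m, ∀ k ≤ m, ∀ l < r + 1,
      ∑ q ∈ Finset.Ico (((l + 1) * m + k) * n) M, y i q = (if k ≤ i then 1 else -1) * (-1) ^ l := by
    intro i hi k hk l hl
    show ∑ q ∈ Finset.Ico (((l + 1) * m + k) * n) M, Function.extend (φ i) a 0 q = _
    rw [sum_extend a n M _ (φ i) (hφ i) ha (hM i hi)]
    have hcell : ∀ x < n, ((l + 1) * m + k) * n ≤ φ i x ↔ (l + 1) * m + k ≤ lev x * m + i := by
      intro x hx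
      show ((l + 1) * m + k) * n ≤ (lev x * m + i) * n + x ↔ _
      constructor
      · intro h
        by_contra hcon
        have h2 : lev x * m + i + 1 ≤ (l + 1) * m + k := by omega
        have h3 := Nat.mul_le_mul_right n h2
        rw [add_mul _ 1 n] at h3
        omega
      · intro h
        have h3 := Nat.mul_le_mul_right n h
        omega
    have hset : ∀ l' < r + 2, (∀ x < n, (l + 1) * m + k ≤ lev x * m + i ↔ l' + 1 ≤ lev x) →
        (Finset.range n).filter (fun x => ((l + 1) * m + k) * n ≤ φ i x) = Finset.Ico (j l') n := by
      intro l' hl' h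
      ext x
      simp only [Finset.mem_filter, Finset.mem_range, Finset.mem_Ico]
      constructor
      · rintro ⟨hx, h2⟩
        exact ⟨(hlev_iff l' hl' x).1 ((h x hx).1 ((hcell x hx).1 h2)), hx⟩
      · rintro ⟨h2, hx⟩
        exact ⟨hx, (hcell x hx).2 ((h x hx).2 ((hlev_iff l' hl' x).2 h2))⟩
    split_ifs with hki
    · rw [hset l (by omega), htail l (by omega), one_mul]
      intro x hx
      constructor
      · intro h
        by_contra hcon
        have := Nat.mul_le_mul_right m (show lev x ≤ l by omega)
        rw [add_mul] at h
        omega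
      · intro h
        have := Nat.mul_le_mul_right m h
        omega
    · rw [hset (l + 1) (by omega), htail (l + 1) (by omega), pow_succ]
      · ring
      intro x hx
      constructor
      · intro h
        by_contra hcon
        have := Nat.mul_le_mul_right m (show lev x ≤ l + 1 by omega)
        omega
      · intro h
        have := Nat.mul_le_mul_right m h
        rw [add_mul (l + 1) 1 m] at this
        omega
  have hmR : (0 : ℝ) < m := by exact_mod_cast hm
  -- lower bound for sums
  have hS : ∀ k ≤ m, (m : ℝ) * κ₁ ≤
      QQ G M (fun q => ∑ i ∈ Finset.range m, (if k ≤ i then 1 else -1) * y i q) := by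
    intro k hk
    have hmem : QQ G M (fun q => (m : ℝ)⁻¹ *
        ∑ i ∈ Finset.range m, (if k ≤ i then 1 else -1) * y i q) ∈ KK G (r + 1) := by
      refine ⟨M, _, fun l => ((l + 1) * m + k) * n, ?_, ?_, ?_, rfl⟩
      · intro l _
        have : (l + 1) * m + k < (l + 1 + 1) * m + k := by
          have : (l + 1 + 1) * m = (l + 1) * m + m := by ring
          omega
        exact Nat.mul_lt_mul_of_pos_right this hn
      · intro q hq
        rw [Finset.sum_eq_zero, mul_zero]
        intro i hi
        rw [hy0 i (Finset.mem_range.1 hi) q hq, mul_zero]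
      · intro l hl
        rw [← Finset.mul_sum, Finset.sum_comm]
        have : ∀ i ∈ Finset.range m, ∑ q ∈ Finset.Ico (((l + 1) * m + k) * n) M,
            (if k ≤ i then (1 : ℝ) else -1) * y i q = (-1) ^ l := by
          intro i hi
          rw [← Finset.mul_sum, htl i (Finset.mem_range.1 hi) k hk l hl, ← mul_assoc]
          split_ifs <;> norm_num
        rw [Finset.sum_congr rfl this]
        simp [hmR.ne']
    have h1 := hk1le _ hmem
    rw [hG.Qsmul, abs_of_pos (inv_pos.2 hmR)] at h1
    rwa [le_inv_mul_iff₀ hmR] at h1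
  -- scaling
  let s : ℝ := ((1 + δ / 2) * κ₂)⁻¹
  have hs : 0 < s := by positivity
  refine ⟨M, fun i q => s * y i q, ?_, ?_⟩
  · intro i hi
    rw [hG.Qsmul, abs_of_pos hs]
    have : QQ G M (y i) = QQ G n a := hG.spread a n M (φ i) (hφ i) ha (hM i hi)
    rw [this]
    simp only [s]
    rw [inv_mul_le_iff₀ (by positivity)]
    linarith
  · intro k hk
    have e : (fun q => ∑ i ∈ Finset.range m, (if k ≤ i then (1 : ℝ) else -1) * (s * y i q)) =
        fun q => s * ∑ i ∈ Finset.range m, (if k ≤ i then 1 else -1) * y i q := by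
      funext q
      rw [Finset.mul_sum]
      exact Finset.sum_congr rfl fun i _ => by ring
    rw [e, hG.Qsmul, abs_of_pos hs]
    refine le_trans ?_ (mul_le_mul_of_nonneg_left (hS k hk) hs.le)
    simp only [s]
    rw [le_inv_mul_iff₀ (by positivity)]
    have h3 : (1 + δ / 2) * κ₂ * (1 - δ) ≤ κ₁ := by
      refine le_trans ?_ hkk
      nlinarith [mul_pos hδ hk2, mul_pos (mul_pos hδ hδ) hk2]
    nlinarith

end James
end LampAux

namespace LampAux
section PassX
variable {X : Type*} [NormedAddCommGroup X] [NormedSpace ℝ X]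

/-- Signs: `+1` for `i ≥ k`, `-1` for `i < k`. -/
def sg (k i : ℕ) : ℝ := if k ≤ i then 1 else -1

theorem abs_sg (k i : ℕ) : |sg k i| = 1 := by
  unfold sg; split_ifs <;> simp

/-- From an `ℓ₂`-sum to a coordinate. -/
theorem coord_pick (Ω : Type) [Fintype Ω] (m : ℕ) (hm : 0 < m) (η : ℝ) (hη : 0 < η) (hη1 : η ≤ 1)
    (Y : ℕ → PiLp 2 (fun _ : Ω => X)) (δ : ℝ) (hδ : 0 < δ) (hδ2 : δ * (40 * (m + 1) * m) ≤ η ^ 2)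
    (hY : ∀ i < m, ‖Y i‖ ≤ 1 + δ)
    (hS : ∀ k ≤ m, m * (1 - δ) - δ ≤ ‖∑ i ∈ Finset.range m, sg k i • Y i‖) :
    ∃ x : ℕ → X, (∀ i < m, ‖x i‖ ≤ 1 + η) ∧
      ∀ k ≤ m, m - η ≤ ‖∑ i ∈ Finset.range m, sg k i • x i‖ := by
  have hmR : (1 : ℝ) ≤ m := by exact_mod_cast hm
  have hδs : δ ≤ 1 / 80 := by
    have h1 : δ * 80 ≤ δ * (40 * (m + 1) * m) := by
      apply mul_le_mul_of_nonneg_left _ hδ.le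
      nlinarith
    nlinarith
  let A : Ω → ℝ := fun ω => ∑ i ∈ Finset.range m, ‖Y i ω‖ ^ 2
  let N : ℕ → Ω → ℝ := fun k ω => ‖∑ i ∈ Finset.range m, sg k i • Y i ω‖
  have hNle : ∀ k ω, N k ω ^ 2 ≤ m * A ω := by
    intro k ω
    have h1 : N k ω ≤ ∑ i ∈ Finset.range m, ‖Y i ω‖ := by
      refine (norm_sum_le _ _).trans (le_of_eq (Finset.sum_congr rfl fun i _ => ?_))
      rw [norm_smul, Real.norm_eq_abs, abs_sg, one_mul]
    have h2 : (∑ i ∈ Finset.range m, ‖Y i ω‖) ^ 2 ≤ m * A ω := by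
      have := sq_sum_le_card_mul_sum_sq (s := Finset.range m) (f := fun i => ‖Y i ω‖)
      simpa using this
    refine le_trans ?_ h2
    exact pow_le_pow_left₀ (norm_nonneg _) h1 2
  have hA0 : ∀ ω, 0 ≤ A ω := fun ω => Finset.sum_nonneg fun i _ => by positivity
  have hAs : ∑ ω, A ω ≤ m * (1 + δ) ^ 2 := by
    simp only [A]
    rw [Finset.sum_comm]
    calc _ = ∑ i ∈ Finset.range m, ‖Y i‖ ^ 2 := Finset.sum_congr rfl fun i _ => by
          rw [PiLp.norm_sq_eq_of_L2]
      _ ≤ ∑ i ∈ Finset.range m, (1 + δ) ^ 2 := Finset.sum_le_sum fun i hi =>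
          pow_le_pow_left₀ (norm_nonneg _) (hY i (Finset.mem_range.1 hi)) 2
      _ = _ := by simp
  have hNs : ∀ k ≤ m, (m * (1 - δ) - δ) ^ 2 ≤ ∑ ω, N k ω ^ 2 := by
    intro k hk
    have e : ∑ ω, N k ω ^ 2 = ‖∑ i ∈ Finset.range m, sg k i • Y i‖ ^ 2 := by
      rw [PiLp.norm_sq_eq_of_L2]
      refine Finset.sum_congr rfl fun ω _ => ?_
      congr 2
      rw [WithLp.ofLp_sum, Finset.sum_apply]
      rfl
    rw [e]
    refine pow_le_pow_left₀ ?_ (hS k hk) 2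
    nlinarith
  let η₀ : ℝ := η ^ 2 / 2
  have hη₀ : 0 < η₀ := by positivity
  have hη₀1 : η₀ ≤ η := by simp only [η₀]; nlinarith
  let D : Ω → ℝ := fun ω => ∑ k ∈ Finset.range (m + 1), (m * A ω - N k ω ^ 2)
  have hD : ∑ ω, D ω < ∑ ω, η₀ * A ω := by
    have h1 : ∑ ω, D ω ≤ (m + 1) * (m * (m * (1 + δ) ^ 2) - (m * (1 - δ) - δ) ^ 2) := by
      simp only [D]
      rw [Finset.sum_comm]
      calc _ ≤ ∑ k ∈ Finset.range (m + 1), (m * (m * (1 + δ) ^ 2) - (m * (1 - δ) - δ) ^ 2) := by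
            refine Finset.sum_le_sum fun k hk => ?_
            rw [Finset.sum_sub_distrib, ← Finset.mul_sum]
            have := hNs k (by have := Finset.mem_range.1 hk; omega)
            have := mul_le_mul_of_nonneg_left hAs (by linarith : (0 : ℝ) ≤ m)
            linarith
        _ = _ := by
            rw [Finset.sum_const, Finset.card_range, nsmul_eq_mul]; push_cast; ring
    have h2 : (m * (1 - δ) - δ) ^ 2 ≤ m * ∑ ω, A ω := by
      refine (hNs 0 (by omega)).trans ?_
      rw [Finset.mul_sum]
      exact Finset.sum_le_sum fun ω _ => hNle 0 ω
    have h3 : (m : ℝ) / 2 ≤ ∑ ω, A ω := by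
      have : (m : ℝ) * (m / 2) ≤ (m * (1 - δ) - δ) ^ 2 := by
        have : m * (39 / 40 : ℝ) ≤ m * (1 - δ) - δ := by nlinarith
        nlinarith
      exact le_of_mul_le_mul_left (this.trans h2) (by linarith)
    have h4 : (m * (m * (1 + δ) ^ 2) - (m * (1 - δ) - δ) ^ 2) ≤ 6 * δ * m ^ 2 := by
      have e : (m * (m * (1 + δ) ^ 2) - (m * (1 - δ) - δ) ^ 2) =
          4 * δ * (m * m) + 2 * (m : ℝ) * δ * (1 - δ) - δ ^ 2 := by ring
      rw [e]
      have : (m : ℝ) ≤ m * m := by nlinarith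
      nlinarith [mul_nonneg hδ.le (by linarith : (0 : ℝ) ≤ m), sq_nonneg δ,
        mul_le_mul_of_nonneg_left this hδ.le,
        mul_nonneg (mul_nonneg hδ.le hδ.le) (by linarith : (0 : ℝ) ≤ m)]
    rw [← Finset.mul_sum]
    calc _ ≤ _ := h1
      _ ≤ ((m : ℝ) + 1) * (6 * δ * m ^ 2) := by gcongr
      _ = (δ * (40 * (m + 1) * m)) * (6 * m / 40) := by ring
      _ ≤ η ^ 2 * (6 * m / 40) := by gcongr
      _ < η₀ * (m / 2) := by
        simp only [η₀]
        have := mul_pos (pow_pos hη 2) (by linarith : (0 : ℝ) < m)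
        nlinarith
      _ ≤ _ := by gcongr
  obtain ⟨ω, -, hω⟩ := Finset.exists_lt_of_sum_lt hD
  have hD0 : ∀ k ∈ Finset.range (m + 1), 0 ≤ m * A ω - N k ω ^ 2 := fun k _ => by
    linarith [hNle k ω]
  have hDk : ∀ k ≤ m, m * A ω - N k ω ^ 2 ≤ η₀ * A ω := fun k hk =>
    (Finset.single_le_sum hD0 (Finset.mem_range.2 (by omega))).trans hω.le
  have hAp : 0 < A ω := by
    have : 0 ≤ D ω := Finset.sum_nonneg hD0
    have : 0 < η₀ * A ω := lt_of_le_of_lt this hω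
    exact pos_of_mul_pos_right this hη₀.le
  let t : ℝ := √(m / A ω)
  have ht2 : t ^ 2 * A ω = m := by
    simp only [t]
    rw [Real.sq_sqrt (by positivity), div_mul_cancel₀ _ hAp.ne']
  have ht : 0 ≤ t := Real.sqrt_nonneg _
  have hSx : ∀ k ≤ m, m - η₀ ≤ ‖∑ i ∈ Finset.range m, sg k i • (t • Y i ω)‖ := by
    intro k hk
    have e : ∑ i ∈ Finset.range m, sg k i • (t • Y i ω) =
        t • ∑ i ∈ Finset.range m, sg k i • Y i ω := by
      rw [Finset.smul_sum]
      exact Finset.sum_congr rfl fun i _ => smul_comm _ _ _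
    rw [e, norm_smul, Real.norm_of_nonneg ht]
    show m - η₀ ≤ t * N k ω
    have h1 := mul_le_mul_of_nonneg_left (hDk k hk) (sq_nonneg t)
    have h2 : (m - η₀) ^ 2 ≤ (t * N k ω) ^ 2 := by
      have e2 : t ^ 2 * (m * A ω - N k ω ^ 2) = m * (t ^ 2 * A ω) - (t * N k ω) ^ 2 := by ring
      have e3 : t ^ 2 * (η₀ * A ω) = η₀ * (t ^ 2 * A ω) := by ring
      rw [e2, e3, ht2] at h1
      nlinarith
    exact le_of_sq_le_sq h2 (mul_nonneg ht (norm_nonneg _))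
  refine ⟨fun i => t • Y i ω, ?_, fun k hk => by linarith [hSx k hk]⟩
  intro i hi
  have hsum : m - η₀ ≤ ∑ i ∈ Finset.range m, ‖t • Y i ω‖ := by
    refine (hSx 0 (by omega)).trans ((norm_sum_le _ _).trans (le_of_eq ?_))
    refine Finset.sum_congr rfl fun i _ => ?_
    rw [norm_smul, Real.norm_eq_abs, abs_sg, one_mul]
  have hsq : ∑ i ∈ Finset.range m, ‖t • Y i ω‖ ^ 2 = m := by
    rw [← ht2]
    simp only [A, Finset.mul_sum]
    refine Finset.sum_congr rfl fun i _ => ?_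
    rw [norm_smul, mul_pow, Real.norm_of_nonneg ht]
  have hvar : ∑ i ∈ Finset.range m, (‖t • Y i ω‖ - 1) ^ 2 ≤ η ^ 2 := by
    have e : ∑ i ∈ Finset.range m, (‖t • Y i ω‖ - 1) ^ 2 =
        ∑ i ∈ Finset.range m, ‖t • Y i ω‖ ^ 2 - 2 * ∑ i ∈ Finset.range m, ‖t • Y i ω‖ + m := by
      rw [Finset.mul_sum, ← Finset.sum_sub_distrib]
      have : (m : ℝ) = ∑ i ∈ Finset.range m, (1 : ℝ) := by simp
      conv_rhs => rw [this]
      rw [← Finset.sum_add_distrib]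
      exact Finset.sum_congr rfl fun i _ => by ring
    rw [e, hsq]
    have : η₀ = η ^ 2 / 2 := rfl
    linarith
  have h1 : (‖t • Y i ω‖ - 1) ^ 2 ≤ η ^ 2 :=
    (Finset.single_le_sum (f := fun i => (‖t • Y i ω‖ - 1) ^ 2) (fun i _ => sq_nonneg _)
      (Finset.mem_range.2 hi)).trans hvar
  have := abs_le_of_sq_le_sq h1 hη.le
  linarith [(abs_le.1 this).2]

theorem exists_flat (ε : ℝ) (hε : 0 < ε) (h : ∀ n, (Der X ε n).Nonempty) (m : ℕ) (hm : 0 < m)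
    (η : ℝ) (hη : 0 < η) (hη1 : η ≤ 1) :
    ∃ x : ℕ → X, (∀ i < m, ‖x i‖ ≤ 1 + η) ∧
      ∀ k ≤ m, m - η ≤ ‖∑ i ∈ Finset.range m, sg k i • x i‖ := by
  have h1 := fun n => bush_L2 ε hε n (h n)
  choose Ω hΩ z hz hlow using h1
  obtain ⟨G, hb, hf, -, hs, hl, hpull⟩ := exists_spread z ε hz hlow
  have hG : SpreadG ε G := ⟨hb, hf, hs, hl⟩
  have hmR : (0 : ℝ) < m := by exact_mod_cast hm
  let δ : ℝ := η ^ 2 / (40 * (m + 1) * m)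
  have hδ : 0 < δ := by positivity
  have hδe : δ * (40 * (m + 1) * m) = η ^ 2 := by simp only [δ]; field_simp
  have hδ1 : δ < 1 := by
    have : (1 : ℝ) ≤ m := by exact_mod_cast hm
    by_contra hcon
    have h1 : 1 * (40 * ((m : ℝ) + 1) * m) ≤ δ * (40 * (m + 1) * m) := by
      apply mul_le_mul_of_nonneg_right (by linarith)
      positivity
    nlinarith
  obtain ⟨M, y, hy1, hy2⟩ := hG.james hε δ hδ hδ1 m hm
  obtain ⟨n, T, hT⟩ := hpull (List.range M) (m + (m + 1)) (Fin.append (fun i : Fin m => y i)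
    (fun k : Fin (m + 1) => fun q => ∑ i ∈ Finset.range m, sg k i * y i q)) δ hδ
  refine coord_pick (Ω n) m hm η hη hη1 (fun i => T (y i)) δ hδ hδe.le ?_ ?_
  · intro i hi
    have h2 := hT (Fin.castAdd (m + 1) ⟨i, hi⟩)
    rw [Fin.append_left] at h2
    have h3 : G ((List.range M).map (y i)) ≤ 1 := hy1 i hi
    have := (abs_lt.1 h2).1
    simp only at this
    linarith
  · intro k hk
    have h2 := hT (Fin.natAdd m ⟨k, by omega⟩)
    rw [Fin.append_right] at h2
    have h3 : m * (1 - δ) ≤ G ((List.range M).map fun q => ∑ i ∈ Finset.range m, sg k i * y i q) :=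
      hy2 k hk
    have := (abs_lt.1 h2).2
    simp only at this
    have e : T (fun q => ∑ i ∈ Finset.range m, sg k i * y i q) =
        ∑ i ∈ Finset.range m, sg k i • T (y i) := by
      have : (fun q => ∑ i ∈ Finset.range m, sg k i * y i q) =
          ∑ i ∈ Finset.range m, sg k i • y i := by
        funext q
        simp
      rw [this, map_sum]
      exact Finset.sum_congr rfl fun i _ => map_smul _ _ _
    rw [e] at this
    linarith

/-- James' summing-type families in `X`. -/
theorem exists_JX (ε : ℝ) (hε : 0 < ε) (h : ∀ n, (Der X ε n).Nonempty) (m : ℕ) :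
    ∃ y : ℕ → X, (∀ i < m, ‖y i‖ ≤ 1) ∧ ∀ (a : ℕ → ℝ) (j : ℕ),
      |∑ i ∈ Finset.Ico j m, a i| ≤ 4 * ‖∑ i ∈ Finset.range m, a i • y i‖ := by
  rcases Nat.eq_zero_or_pos m with hm | hm
  · subst hm
    exact ⟨fun _ => 0, by simp, by simp⟩
  have hmR : (1 : ℝ) ≤ m := by exact_mod_cast hm
  let η : ℝ := 1 / (4 * m ^ 2)
  have hη : 0 < η := by positivity
  have hηe : η * (4 * m ^ 2) = 1 := by simp only [η]; field_simp
  have hη1 : η ≤ 1 := by nlinarith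
  obtain ⟨x, hx, hS⟩ := exists_flat ε hε h m hm η hη hη1
  have hg : ∀ k, ∃ g : StrongDual ℝ X, ‖g‖ ≤ 1 ∧ g (∑ i ∈ Finset.range m, sg k i • x i) =
      ‖∑ i ∈ Finset.range m, sg k i • x i‖ := fun k => by
    simpa using exists_dual_vector'' ℝ (∑ i ∈ Finset.range m, sg k i • x i)
  choose g hg1 hg2 using hg
  have hgx : ∀ k ≤ m, ∀ i < m, |sg k i * g k (x i) - 1| ≤ m * η := by
    intro k hk i hi
    have hup : ∀ i < m, sg k i * g k (x i) ≤ 1 + η := by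
      intro i hi
      calc _ ≤ |sg k i * g k (x i)| := le_abs_self _
        _ = ‖g k (x i)‖ := by rw [abs_mul, abs_sg, one_mul]; rfl
        _ ≤ 1 * ‖x i‖ := (g k).le_of_opNorm_le (hg1 k) _
        _ ≤ 1 + η := by rw [one_mul]; exact hx i hi
    have hsum : m - η ≤ ∑ i ∈ Finset.range m, sg k i * g k (x i) := by
      have := hS k hk
      rw [← hg2 k, map_sum] at this
      simpa using this
    rw [← Finset.add_sum_erase _ _ (Finset.mem_range.2 hi)] at hsum
    have h2 : ∑ i ∈ (Finset.range m).erase i, sg k i * g k (x i) ≤ (m - 1) * (1 + η) := by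
      calc _ ≤ ∑ i ∈ (Finset.range m).erase i, (1 + η) := Finset.sum_le_sum fun i' hi' =>
            hup i' (Finset.mem_range.1 (Finset.mem_of_mem_erase hi'))
        _ = _ := by
          rw [Finset.sum_const, Finset.card_erase_of_mem (Finset.mem_range.2 hi), Finset.card_range,
            nsmul_eq_mul, Nat.cast_sub hm]
          simp
    have h3 := hup i hi
    rw [abs_le]
    constructor <;> nlinarith
  refine ⟨fun i => (1 / 2 : ℝ) • x i, ?_, ?_⟩
  · intro i hi
    rw [norm_smul, Real.norm_of_nonneg (by norm_num)]
    linarith [hx i hi]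
  intro a j
  set V := ∑ i ∈ Finset.range m, a i • x i with hV
  have e : ∑ i ∈ Finset.range m, a i • (1 / 2 : ℝ) • x i = (1 / 2 : ℝ) • V := by
    rw [hV, Finset.smul_sum]
    exact Finset.sum_congr rfl fun i _ => smul_comm _ _ _
  rw [e, norm_smul, Real.norm_of_nonneg (by norm_num)]
  -- approximate functionals
  have happ : ∀ k ≤ m, |∑ i ∈ Finset.Ico k m, a i| ≤ ‖V‖ + m * η * ∑ i ∈ Finset.range m, |a i| := by
    intro k hk
    have hlin : (g 0 V + g k V) / 2 = ∑ i ∈ Finset.range m, a i * ((g 0 (x i) + g k (x i)) / 2) := by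
      rw [hV, map_sum, map_sum, ← Finset.sum_add_distrib, Finset.sum_div]
      refine Finset.sum_congr rfl fun i _ => ?_
      simp; ring
    have htl : ∑ i ∈ Finset.Ico k m, a i = ∑ i ∈ Finset.range m, a i * (if k ≤ i then 1 else 0) := by
      simp only [mul_ite, mul_one, mul_zero]
      rw [← Finset.sum_filter]
      congr 1
      ext i; simp [and_comm]
    have hdiff : |∑ i ∈ Finset.Ico k m, a i - (g 0 V + g k V) / 2| ≤
        m * η * ∑ i ∈ Finset.range m, |a i| := by
      rw [hlin, htl, ← Finset.sum_sub_distrib, Finset.mul_sum]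
      refine (Finset.abs_sum_le_sum_abs _ _).trans (Finset.sum_le_sum fun i hi => ?_)
      have hi := Finset.mem_range.1 hi
      rw [← mul_sub, abs_mul, mul_comm]
      apply mul_le_mul_of_nonneg_right _ (abs_nonneg _)
      have h1 := abs_le.1 (hgx 0 (by omega) i hi)
      have h2 := abs_le.1 (hgx k hk i hi)
      simp only [sg, Nat.zero_le, if_true, one_mul] at h1
      unfold sg at h2
      rw [abs_le]
      split_ifs at h2 ⊢
      · constructor <;> linarith [h1.1, h1.2, h2.1, h2.2]
      · constructor <;> linarith [h1.1, h1.2, h2.1, h2.2]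
    have hgV : ∀ k, |g k V| ≤ ‖V‖ := fun k => by
      have := (g k).le_of_opNorm_le (hg1 k) V
      rw [one_mul] at this
      exact this
    have h3 := abs_le.1 (hgV 0)
    have h4 := abs_le.1 (hgV k)
    have h5 := abs_le.1 hdiff
    rw [abs_le]
    constructor <;> linarith [h3.1, h3.2, h4.1, h4.2, h5.1, h5.2]
  obtain ⟨k₀, hk₀, hmax⟩ := Finset.exists_max_image (Finset.range (m + 1))
    (fun k => |∑ i ∈ Finset.Ico k m, a i|) ⟨0, by simp⟩
  set B := |∑ i ∈ Finset.Ico k₀ m, a i| with hB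
  have hBk : ∀ k ≤ m, |∑ i ∈ Finset.Ico k m, a i| ≤ B := fun k hk =>
    hmax k (Finset.mem_range.2 (by omega))
  have hai : ∀ i < m, |a i| ≤ 2 * B := by
    intro i hi
    have h1 := abs_le.1 (hBk i hi.le)
    have h2 := abs_le.1 (hBk (i + 1) hi)
    have e := Finset.sum_eq_sum_Ico_succ_bot hi a
    rw [abs_le]
    constructor <;> linarith [h1.1, h1.2, h2.1, h2.2]
  have hsa : ∑ i ∈ Finset.range m, |a i| ≤ m * (2 * B) := by
    calc _ ≤ ∑ i ∈ Finset.range m, 2 * B := Finset.sum_le_sum fun i hi =>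
          hai i (Finset.mem_range.1 hi)
      _ = _ := by simp
  have hBB : B ≤ 2 * ‖V‖ := by
    have h1 := happ k₀ (by have := Finset.mem_range.1 hk₀; omega)
    have h2 := mul_le_mul_of_nonneg_left hsa (by positivity : 0 ≤ m * η)
    have e : m * η * (m * (2 * B)) = (η * (4 * m ^ 2)) * (B / 2) := by ring
    rw [e, hηe, one_mul] at h2
    linarith
  have hj : |∑ i ∈ Finset.Ico j m, a i| ≤ B := by
    rcases le_or_gt j m with h | h
    · exact hBk j h
    · rw [Finset.Ico_eq_empty (by omega)]; simp [hB]
  linarith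

end PassX
end LampAux

namespace LampAux
section Block
variable {X : Type*} [NormedAddCommGroup X] [NormedSpace ℝ X]

/-- James-type family of length `n`. -/
def JFam (C : ℝ) (n : ℕ) (y : ℕ → X) : Prop :=
  (∀ i < n, ‖y i‖ ≤ 1) ∧ ∀ (a : ℕ → ℝ) (j : ℕ),
      |∑ i ∈ Finset.Ico j n, a i| ≤ C * ‖∑ i ∈ Finset.range n, a i • y i‖

theorem sum_extend_smul (a : ℕ → ℝ) (n M : ℕ) (φ : ℕ → ℕ) (hφ : StrictMono φ)
    (ha : ∀ x, n ≤ x → a x = 0) (hM : ∀ x < n, φ x < M) (y : ℕ → X) :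
    ∑ q ∈ Finset.range M, Function.extend φ a 0 q • y q =
      ∑ x ∈ Finset.range n, a x • y (φ x) := by
  have hy : ∀ x, Function.extend φ a 0 (φ x) = a x := fun x => hφ.injective.extend_apply a 0 x
  have : ∑ x ∈ Finset.range n, a x • y (φ x) =
      ∑ x ∈ Finset.range n, (fun q => Function.extend φ a 0 q • y q) (φ x) :=
    Finset.sum_congr rfl fun x _ => by simp only [hy]
  rw [this, ← Finset.sum_image (f := fun q => Function.extend φ a 0 q • y q)
    (g := φ) fun x _ y _ h => hφ.injective h]
  symm
  apply Finset.sum_subset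
  · intro q hq
    simp only [Finset.mem_image, Finset.mem_range] at hq
    obtain ⟨x, hx, rfl⟩ := hq
    exact Finset.mem_range.2 (hM x hx)
  · intro q hq hq'
    by_cases hex : ∃ x, φ x = q
    · obtain ⟨x, rfl⟩ := hex
      rw [hy, ha, zero_smul]
      by_contra hx
      apply hq'
      simp only [Finset.mem_image, Finset.mem_range]
      exact ⟨x, by omega, rfl⟩
    · rw [Function.extend_apply' _ _ _ hex]; simp

theorem JFam.sub {C : ℝ} {N m : ℕ} {x : ℕ → X} (h : JFam C N x) (ψ : ℕ → ℕ) (hψ : StrictMono ψ)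
    (hN : ∀ k < m, ψ k < N) : JFam C m (x ∘ ψ) := by
  refine ⟨fun i hi => h.1 _ (hN i hi), fun a j => ?_⟩
  let a' : ℕ → ℝ := fun k => if k < m then a k else 0
  have ha' : ∀ k, m ≤ k → a' k = 0 := fun k hk => if_neg (by omega)
  have h1 := h.2 (Function.extend ψ a' 0) (ψ j)
  rw [sum_extend_smul a' m N ψ hψ ha' hN, sum_extend a' m N (ψ j) ψ hψ ha' hN] at h1
  have e1 : ∑ x ∈ Finset.range m with ψ j ≤ ψ x, a' x = ∑ i ∈ Finset.Ico j m, a i := by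
    refine Finset.sum_congr ?_ fun i hi => if_pos (Finset.mem_Ico.1 hi).2
    ext i
    simp [hψ.le_iff_le, and_comm]
  have e2 : ∑ k ∈ Finset.range m, a' k • x (ψ k) = ∑ k ∈ Finset.range m, a k • (x ∘ ψ) k :=
    Finset.sum_congr rfl fun k hk => by simp [a', Finset.mem_range.1 hk]
  rwa [e1, e2] at h1

theorem exists_strictMono_of_card (H : Finset ℕ) (m : ℕ) (h : m ≤ H.card) :
    ∃ ψ : ℕ → ℕ, StrictMono ψ ∧ ∀ k < m, ψ k ∈ H := by
  let B := H.sup id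
  let f := H.orderEmbOfFin rfl
  have hf : ∀ k, f k ≤ B := fun k => Finset.le_sup (f := id) (H.orderEmbOfFin_mem rfl k)
  refine ⟨fun k => if hk : k < H.card then f ⟨k, hk⟩ else B + 1 + k, ?_, ?_⟩
  · intro k k' hkk
    simp only
    split_ifs with h1 h2 h2
    · exact f.strictMono hkk
    · have := hf ⟨k, h1⟩
      omega
    · omega
    · omega
  · intro k hk
    simp only [show k < H.card by omega, dif_pos]
    exact H.orderEmbOfFin_mem rfl _

/-- Families almost constant under finitely many functionals. -/
theorem exists_J_const (hJ : ∀ n, ∃ y : ℕ → X, JFam 4 n y) {ι : Type*} [Fintype ι]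
    (φ : ι → StrongDual ℝ X) (hφ : ∀ t, ‖φ t‖ ≤ 1) (m : ℕ) (σ : ℝ) (hσ : 0 < σ) :
    ∃ u : ℕ → X, JFam 4 m u ∧ ∀ k < m, ∀ k' < m, ∀ t, |φ t (u k) - φ t (u k')| ≤ 2 * σ := by
  obtain ⟨s, -, hs, hcov⟩ := finite_cover_balls_of_compact
    (isCompact_closedBall (0 : ι → ℝ) 1) hσ
  obtain ⟨x, hx⟩ := hJ (hs.toFinset.card * m + 1)
  have hin : ∀ i < hs.toFinset.card * m + 1, ∃ c ∈ s, ∀ t, |φ t (x i) - c t| ≤ σ := by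
    intro i hi
    have : (fun t => φ t (x i)) ∈ Metric.closedBall (0 : ι → ℝ) 1 := by
      rw [mem_closedBall_zero_iff, pi_norm_le_iff_of_nonneg zero_le_one]
      intro t
      refine ((φ t).le_of_opNorm_le (hφ t) _).trans ?_
      rw [one_mul]; exact hx.1 i hi
    have := hcov this
    simp only [Set.mem_iUnion] at this
    obtain ⟨c, hc, hb⟩ := this
    refine ⟨c, hc, fun t => ?_⟩
    have h1 := (dist_le_pi_dist (fun t => φ t (x i)) c t).trans (Metric.mem_ball.1 hb).le
    exact h1
  choose! c hc hcx using hin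
  obtain ⟨c₀, -, hcard⟩ := Finset.exists_lt_card_fiber_of_mul_lt_card_of_maps_to
    (s := Finset.range (hs.toFinset.card * m + 1)) (t := hs.toFinset) (f := c) (n := m)
    (fun i hi => by simpa using hc i (Finset.mem_range.1 hi)) (by simp)
  obtain ⟨ψ, hψ, hmem⟩ := exists_strictMono_of_card _ m hcard.le
  simp only [Finset.mem_filter, Finset.mem_range] at hmem
  refine ⟨x ∘ ψ, hx.sub ψ hψ fun k hk => (hmem k hk).1, fun k hk k' hk' t => ?_⟩
  have h1 := hcx (ψ k) (hmem k hk).1 t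
  have h2 := hcx (ψ k') (hmem k' hk').1 t
  rw [(hmem k hk).2] at h1
  rw [(hmem k' hk').2] at h2
  rw [abs_le] at *
  simp only [Function.comp_apply]
  constructor <;> linarith [h1.1, h1.2, h2.1, h2.2]

theorem JFam.coef {C : ℝ} {n : ℕ} {y : ℕ → X} (h : JFam C n y) (a : ℕ → ℝ) (i : ℕ) (hi : i < n) :
    |a i| ≤ 2 * C * ‖∑ i ∈ Finset.range n, a i • y i‖ := by
  have h1 := abs_le.1 (h.2 a i)
  have h2 := abs_le.1 (h.2 a (i + 1))
  have e := Finset.sum_eq_sum_Ico_succ_bot hi a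
  rw [abs_le]
  constructor <;> linarith [h1.1, h1.2, h2.1, h2.2]

/-- Families almost annihilated by finitely many functionals. -/
theorem exists_J_small (hJ : ∀ n, ∃ y : ℕ → X, JFam 4 n y) {ι : Type*} [Fintype ι]
    (φ : ι → StrongDual ℝ X) (hφ : ∀ t, ‖φ t‖ ≤ 1) (n : ℕ) (s : ℝ) (hs : 0 < s) :
    ∃ y : ℕ → X, JFam 8 n y ∧ ∀ (a : ℕ → ℝ) t,
      |φ t (∑ i ∈ Finset.range n, a i • y i)| ≤ s * ‖∑ i ∈ Finset.range n, a i • y i‖ := by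
  obtain ⟨u, hu, hc⟩ := exists_J_const hJ φ hφ (n + 1) (s / (16 * (n + 1))) (by positivity)
  let y : ℕ → X := fun k => (1 / 2 : ℝ) • (u (k + 1) - u 0)
  have hy : JFam 8 n y := by
    constructor
    · intro i hi
      simp only [y]
      rw [norm_smul, Real.norm_of_nonneg (by norm_num)]
      have := norm_sub_le (u (i + 1)) (u 0)
      have := hu.1 (i + 1) (by omega)
      have := hu.1 0 (by omega)
      linarith
    · intro a j
      let a' : ℕ → ℝ := fun k => Nat.casesOn k (-(∑ i ∈ Finset.range n, a i) / 2) fun k => a k / 2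
      have h1 := hu.2 a' (j + 1)
      have e1 : ∑ i ∈ Finset.Ico (j + 1) (n + 1), a' i = (∑ i ∈ Finset.Ico j n, a i) / 2 := by
        rw [← Finset.sum_Ico_add' (fun i => a' i) j n 1, Finset.sum_div]
      have e2 : ∑ i ∈ Finset.range (n + 1), a' i • u i = ∑ i ∈ Finset.range n, a i • y i := by
        rw [Finset.sum_range_succ']
        simp only [a', y]
        simp only [smul_sub, Finset.sum_sub_distrib, smul_smul]
        rw [← Finset.sum_smul, sub_eq_add_neg, ← neg_smul, ← Finset.sum_mul]
        congr 1
        · exact Finset.sum_congr rfl fun i _ => by congr 1; ring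
        · congr 1
          show (-∑ i ∈ Finset.range n, a i) / 2 = _
          ring
      rw [e1, e2, abs_div, abs_of_pos (two_pos : (0 : ℝ) < 2)] at h1
      linarith
  refine ⟨y, hy, fun a t => ?_⟩
  set w := ∑ i ∈ Finset.range n, a i • y i with hw
  rw [hw, map_sum, ← hw]
  refine (Finset.abs_sum_le_sum_abs _ _).trans ?_
  have : ∀ i ∈ Finset.range n, |φ t (a i • y i)| ≤ s * ‖w‖ / (n + 1) := by
    intro i hi
    have hi := Finset.mem_range.1 hi
    have h1 := hy.coef a i hi
    have h2 := hc (i + 1) (by omega) 0 (by omega) t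
    have e : φ t (a i • y i) = a i * ((φ t (u (i + 1)) - φ t (u 0)) / 2) := by
      simp only [y, map_smul, map_sub, smul_eq_mul]; ring
    rw [e, abs_mul, abs_div, abs_of_pos (two_pos : (0 : ℝ) < 2)]
    calc _ ≤ (2 * 8 * ‖w‖) * (s / (16 * (n + 1))) := by
          refine mul_le_mul h1 (by linarith) (by positivity) (by positivity)
      _ = _ := by field_simp; try ring
  calc _ ≤ ∑ i ∈ Finset.range n, s * ‖w‖ / (n + 1) := Finset.sum_le_sum this
    _ = s * ‖w‖ * (n / (n + 1)) := by simp; ring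
    _ ≤ s * ‖w‖ * 1 := by
        gcongr
        rw [div_le_one (by positivity)]; linarith
    _ = _ := mul_one _

/-- A new family almost orthogonal to a finite dimensional space. -/
theorem exists_J_orth (hJ : ∀ n, ∃ y : ℕ → X, JFam 4 n y) (E : Submodule ℝ X)
    [FiniteDimensional ℝ E] (η : ℝ) (hη : 0 < η) (n : ℕ) :
    ∃ y : ℕ → X, JFam 8 n y ∧ ∀ e ∈ E, ∀ a : ℕ → ℝ,
      ‖e‖ ≤ (1 + η) * ‖e + ∑ i ∈ Finset.range n, a i • y i‖ := by
  let s : ℝ := η / (3 + 2 * η)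
  have hs : 0 < s := by positivity
  have hse : s * (3 + 2 * η) = η := by simp only [s]; field_simp
  obtain ⟨net, hnet, hfin, hcov⟩ := finite_cover_balls_of_compact
    (isCompact_sphere (0 : E) 1) hs
  have hd : ∀ t : net, ∃ g : StrongDual ℝ X, ‖g‖ ≤ 1 ∧ g (t : E) = ‖((t : E) : X)‖ := fun t => by
    simpa using exists_dual_vector'' ℝ (((t : E) : X))
  choose g hg1 hg2 using hd
  have : Fintype net := hfin.fintype
  obtain ⟨y, hy, hys⟩ := exists_J_small hJ g hg1 n s hs
  refine ⟨y, hy, ?_⟩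
  have hunit : ∀ e ∈ E, ‖e‖ = 1 → ∀ a : ℕ → ℝ,
      1 ≤ (1 + η) * ‖e + ∑ i ∈ Finset.range n, a i • y i‖ := by
    intro e he hen a
    have : (⟨e, he⟩ : E) ∈ Metric.sphere (0 : E) 1 := by simpa using hen
    have := hcov this
    simp only [Set.mem_iUnion] at this
    obtain ⟨t, ht, hb⟩ := this
    set w := ∑ i ∈ Finset.range n, a i • y i
    have h1 := hys a ⟨t, ht⟩
    have htn : ‖(t : X)‖ = 1 := by simpa using hnet ht
    have h2 : g ⟨t, ht⟩ (t : X) = 1 := by rw [← htn]; exact hg2 ⟨t, ht⟩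
    have h3 : ‖e - t‖ < s := by
      have := Metric.mem_ball.1 hb
      rw [dist_eq_norm] at this
      exact this
    have h4 : |g ⟨t, ht⟩ (e - t)| ≤ ‖e - t‖ := by
      have := (g ⟨t, ht⟩).le_of_opNorm_le (hg1 _) (e - t)
      rwa [one_mul] at this
    have h5 : |g ⟨t, ht⟩ (e + w)| ≤ ‖e + w‖ := by
      have := (g ⟨t, ht⟩).le_of_opNorm_le (hg1 _) (e + w)
      rwa [one_mul] at this
    have h6 : ‖w‖ ≤ ‖e + w‖ + 1 := by
      have := norm_sub_le (e + w) e
      rw [add_sub_cancel_left, hen] at this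
      exact this
    rw [map_sub] at h4
    rw [map_add] at h5
    have h7 : 1 - s - s * (‖e + w‖ + 1) ≤ ‖e + w‖ := by
      have a1 := (abs_le.1 h4).1
      have a2 := (abs_le.1 h5).2
      have a3 := (abs_le.1 h1).1
      have a4 := mul_le_mul_of_nonneg_left h6 hs.le
      linarith
    have h8 : (1 - 2 * s) ≤ (1 + s) * ‖e + w‖ := by linarith
    have h9 : 0 < 1 - 2 * s := by nlinarith
    have h10 : 1 + s ≤ (1 + η) * (1 - 2 * s) := by nlinarith
    have h11 : (1 + s) * ‖e + w‖ ≤ (1 + η) * (1 - 2 * s) * ‖e + w‖ := by gcongr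
    have h12 : (1 - 2 * s) * 1 ≤ (1 - 2 * s) * ((1 + η) * ‖e + w‖) := by linarith
    exact le_of_mul_le_mul_left h12 h9
  intro e he a
  rcases eq_or_ne e 0 with h0 | h0
  · subst h0
    rw [norm_zero]; positivity
  have hep : 0 < ‖e‖ := norm_pos_iff.2 h0
  have h1 := hunit (‖e‖⁻¹ • e) (E.smul_mem _ he) (by
    rw [norm_smul, norm_inv, norm_norm, inv_mul_cancel₀ hep.ne']) (fun i => ‖e‖⁻¹ * a i)
  have e2 : ‖e‖⁻¹ • e + ∑ i ∈ Finset.range n, (‖e‖⁻¹ * a i) • y i =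
      ‖e‖⁻¹ • (e + ∑ i ∈ Finset.range n, a i • y i) := by
    rw [smul_add, Finset.smul_sum]
    simp only [mul_smul]
  rw [e2, norm_smul, norm_inv, norm_norm, ← mul_assoc, mul_comm (1 + η), mul_assoc,
    le_inv_mul_iff₀ hep, mul_one] at h1
  exact h1

end Block
end LampAux

namespace LampAux
section Block2
variable {X : Type*} [NormedAddCommGroup X] [NormedSpace ℝ X]

theorem exists_blocks (hJ : ∀ n, ∃ y : ℕ → X, JFam 4 n y) (n : ℕ → ℕ) :
    ∃ y : ℕ → ℕ → X, (∀ k, JFam 8 (n k) (y k)) ∧ ∀ (a : ℕ → ℕ → ℝ) (K k : ℕ), k < K →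
      ‖∑ i ∈ Finset.range (n k), a k i • y k i‖ ≤
        4 * ‖∑ l ∈ Finset.range K, ∑ i ∈ Finset.range (n l), a l i • y l i‖ := by
  let A : ℕ → ℝ := fun k => 2 - (1 / 2) ^ k
  have hA1 : ∀ k, 1 ≤ A k := fun k => by
    have : ((1 : ℝ) / 2) ^ k ≤ 1 := pow_le_one₀ (by norm_num) (by norm_num)
    simp only [A]; linarith
  have hA2 : ∀ k, A k ≤ 2 := fun k => by
    have : (0 : ℝ) < (1 / 2) ^ k := by positivity
    simp only [A]; linarith
  have hA3 : ∀ k, A k < A (k + 1) := fun k => by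
    have : (0 : ℝ) < (1 / 2) ^ k := by positivity
    simp only [A, pow_succ]; linarith
  have key : ∀ (k : ℕ) (E : {E : Submodule ℝ X // FiniteDimensional ℝ E}),
      ∃ y : ℕ → X, JFam 8 (n k) y ∧ ∀ e ∈ E.1, ∀ a : ℕ → ℝ,
        A k * ‖e‖ ≤ A (k + 1) * ‖e + ∑ i ∈ Finset.range (n k), a i • y i‖ := by
    intro k E
    have := E.2
    have hk : 0 < A k := by linarith [hA1 k]
    obtain ⟨y, h1, h2⟩ := exists_J_orth hJ E.1 (A (k + 1) / A k - 1)
      (by rw [sub_pos, one_lt_div hk]; exact hA3 k) (n k)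
    refine ⟨y, h1, fun e he a => ?_⟩
    have := mul_le_mul_of_nonneg_left (h2 e he a) hk.le
    rw [← mul_assoc] at this
    rw [add_sub_cancel, mul_div_cancel₀ _ hk.ne'] at this
    exact this
  choose Y hY1 hY2 using key
  let nxt : ℕ → {E : Submodule ℝ X // FiniteDimensional ℝ E} →
      {E : Submodule ℝ X // FiniteDimensional ℝ E} := fun k E =>
    ⟨E.1 ⊔ Submodule.span ℝ (Y k E '' (Finset.range (n k) : Set ℕ)), by
      have := E.2
      have : FiniteDimensional ℝ (Submodule.span ℝ (Y k E '' (Finset.range (n k) : Set ℕ))) :=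
        FiniteDimensional.span_of_finite ℝ ((Finset.finite_toSet _).image _)
      infer_instance⟩
  let E : ℕ → {E : Submodule ℝ X // FiniteDimensional ℝ E} :=
    fun k => Nat.rec ⟨⊥, inferInstance⟩ nxt k
  have hE : ∀ k, E (k + 1) = nxt k (E k) := fun k => rfl
  refine ⟨fun k => Y k (E k), fun k => hY1 k _, fun a K k hk => ?_⟩
  let S : ℕ → X := fun K => ∑ l ∈ Finset.range K, ∑ i ∈ Finset.range (n l), a l i • Y l (E l) i
  have hS : ∀ K, S (K + 1) = S K + ∑ i ∈ Finset.range (n K), a K i • Y K (E K) i :=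
    fun K => Finset.sum_range_succ _ _
  have hmem : ∀ K, S K ∈ (E K).1 := by
    intro K
    induction K with
    | zero => simp [S]
    | succ K ih =>
      rw [hS, hE]
      refine Submodule.add_mem_sup ih (Submodule.sum_mem _ fun i hi => Submodule.smul_mem _ _
        (Submodule.subset_span ⟨i, by simpa using hi, rfl⟩))
  have hmono : Monotone fun K => A K * ‖S K‖ := by
    apply monotone_nat_of_le_succ
    intro K
    have := hY2 K (E K) (S K) (hmem K) (a K)
    rwa [← hS] at this
  have hb : ∀ k ≤ K, ‖S k‖ ≤ 2 * ‖S K‖ := by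
    intro k hk
    have h1 : A k * ‖S k‖ ≤ A K * ‖S K‖ := hmono hk
    have h2 := mul_le_mul_of_nonneg_right (hA1 k) (norm_nonneg (S k))
    have h3 := mul_le_mul_of_nonneg_right (hA2 K) (norm_nonneg (S K))
    linarith
  have e : ∑ i ∈ Finset.range (n k), a k i • Y k (E k) i = S (k + 1) - S k := by
    rw [hS]; abel
  rw [e]
  refine (norm_sub_le _ _).trans ?_
  have h1 := hb k hk.le
  have h2 := hb (k + 1) hk
  change _ ≤ 4 * ‖S K‖
  linarith

end Block2
end LampAux

namespace LampAux
section System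
variable {X : Type*} [NormedAddCommGroup X] [NormedSpace ℝ X]

theorem exists_idx {Q : Type*} (F : Finset Q) (val : Q → ℝ) :
    ∃ idx : Q → ℕ, (∀ q ∈ F, idx q < F.card) ∧
      (∀ q ∈ F, ∀ q' ∈ F, idx q = idx q' → q = q') ∧
      ∀ q ∈ F, ∀ q' ∈ F, idx q ≤ idx q' → val q ≤ val q' := by
  classical
  let f : Fin F.card → ℝ := fun i => val (F.equivFin.symm i)
  let σ := Tuple.sort f
  have hm : Monotone (f ∘ σ) := Tuple.monotone_sort f
  let ix : F → Fin F.card := fun q => σ.symm (F.equivFin q)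
  have hix : ∀ q, f (σ (ix q)) = val q := fun q => by simp [ix, f]
  have hinj : Function.Injective ix := σ.symm.injective.comp F.equivFin.injective
  refine ⟨fun q => if h : q ∈ F then (ix ⟨q, h⟩ : ℕ) else 0, ?_, ?_, ?_⟩
  · intro q hq
    simp [hq]
  · intro q hq q' hq' h
    simp only [hq, hq', dif_pos] at h
    have := hinj (Fin.ext h)
    simpa using this
  · intro q hq q' hq' h
    simp only [hq, hq', dif_pos] at h
    have := hm (show ix ⟨q, hq⟩ ≤ ix ⟨q', hq'⟩ from h)
    simp only [Function.comp_apply, hix] at this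
    exact this

open Classical in
/-- The weight functional. -/
noncomputable def wt {Q : Type*} (κ : Q → ℕ) (k : ℕ) (P : Q → Prop) : (Q →₀ ℝ) →ₗ[ℝ] ℝ :=
  Finsupp.linearCombination ℝ fun q => if κ q = k ∧ P q then (1 : ℝ) else 0

theorem exists_system (hJ : ∀ n, ∃ y : ℕ → X, JFam 4 n y) {Q : Type*} (κ : Q → ℕ)
    (hfin : ∀ k, {q | κ q = k}.Finite) (val : Q → ℝ) :
    ∃ e : Q → X, (∀ q, ‖e q‖ ≤ 1) ∧ ∀ (P : Q → Prop),
      (∀ q q', P q → val q ≤ val q' → P q') → ∀ (k : ℕ) (a : Q →₀ ℝ),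
      |wt κ k P a| ≤ 32 * ‖Finsupp.linearCombination ℝ e a‖ := by
  classical
  let F : ℕ → Finset Q := fun k => (hfin k).toFinset
  have hF : ∀ k q, q ∈ F k ↔ κ q = k := fun k q => by simp [F]
  choose idx hlt hinj hmono using fun k => exists_idx (F k) val
  obtain ⟨y, hy, hcomp⟩ := exists_blocks hJ fun k => (F k).card
  refine ⟨fun q => y (κ q) (idx (κ q) q), fun q => (hy _).1 _ (hlt _ q ((hF _ _).2 rfl)), ?_⟩
  intro P hP k a
  let a' : ℕ → ℕ → ℝ := fun l i => ∑ q ∈ F l with idx l q = i, a q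
  have hblock : ∀ l, ∑ i ∈ Finset.range (F l).card, a' l i • y l i =
      ∑ q ∈ F l, a q • y (κ q) (idx (κ q) q) := by
    intro l
    rw [← Finset.sum_fiberwise_of_maps_to (s := F l) (t := Finset.range (F l).card) (g := idx l)
      (fun q hq => Finset.mem_range.2 (hlt l q hq))]
    refine Finset.sum_congr rfl fun i _ => ?_
    simp only [a']
    rw [Finset.sum_smul]
    refine Finset.sum_congr rfl fun q hq => ?_
    rw [Finset.mem_filter, hF] at hq
    rw [hq.1, hq.2]
  let K := max (a.support.sup κ) k + 1
  have htot : Finsupp.linearCombination ℝ (fun q => y (κ q) (idx (κ q) q)) a =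
      ∑ l ∈ Finset.range K, ∑ i ∈ Finset.range (F l).card, a' l i • y l i := by
    rw [Finsupp.linearCombination_apply, Finsupp.sum,
      ← Finset.sum_fiberwise_of_maps_to (s := a.support) (t := Finset.range K) (g := κ)]
    · refine Finset.sum_congr rfl fun l _ => ?_
      rw [hblock]
      apply Finset.sum_subset
      · intro q hq
        rw [Finset.mem_filter] at hq
        exact (hF _ _).2 hq.2
      · intro q hq hq'
        rw [hF] at hq
        have : a q = 0 := by
          by_contra h
          exact hq' (Finset.mem_filter.2 ⟨Finsupp.mem_support_iff.2 h, hq⟩)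
        rw [this, zero_smul]
    · intro q hq
      have : κ q ≤ a.support.sup κ := Finset.le_sup hq
      simp only [K, Finset.mem_range]
      omega
  have h1 := hcomp a' K k (by simp only [K]; omega)
  rw [← htot] at h1
  have hwt : wt κ k P a = ∑ q ∈ F k with P q, a q := by
    rw [wt, Finsupp.linearCombination_apply, Finsupp.sum]
    simp only [smul_eq_mul, mul_ite, mul_one, mul_zero]
    rw [← Finset.sum_filter]
    apply Finset.sum_subset
    · intro q hq
      simp only [Finset.mem_filter] at hq ⊢
      exact ⟨(hF _ _).2 hq.2.1, hq.2.2⟩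
    · intro q hq hq'
      simp only [Finset.mem_filter, Finsupp.mem_support_iff, hF] at hq hq'
      by_contra h
      exact hq' ⟨h, hq⟩
  have hcut : ∃ j, ∀ q ∈ F k, (P q ↔ j ≤ idx k q) := by
    rcases (Finset.filter P (F k)).eq_empty_or_nonempty with h0 | h0
    · refine ⟨(F k).card, fun q hq => ?_⟩
      have := hlt k q hq
      constructor
      · intro h
        have : q ∈ Finset.filter P (F k) := Finset.mem_filter.2 ⟨hq, h⟩
        simp [h0] at this
      · intro h; omega
    · obtain ⟨q₀, hq₀, hmin⟩ := Finset.exists_min_image _ (idx k) h0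
      rw [Finset.mem_filter] at hq₀
      refine ⟨idx k q₀, fun q hq => ⟨fun h => hmin q (Finset.mem_filter.2 ⟨hq, h⟩), fun h => ?_⟩⟩
      exact hP q₀ q hq₀.2 (hmono k q₀ hq₀.1 q hq h)
  obtain ⟨j, hj⟩ := hcut
  have h2 := (hy k).2 (a' k) j
  have e2 : ∑ i ∈ Finset.Ico j (F k).card, a' k i = ∑ q ∈ F k with P q, a q := by
    rw [← Finset.sum_fiberwise_of_maps_to (s := (F k).filter P) (t := Finset.Ico j (F k).card)
      (g := idx k)]
    · refine Finset.sum_congr rfl fun i hi => ?_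
      refine Finset.sum_congr ?_ fun _ _ => rfl
      ext q
      simp only [Finset.mem_filter]
      rw [Finset.mem_Ico] at hi
      constructor
      · rintro ⟨h, rfl⟩
        exact ⟨⟨h, (hj q h).2 hi.1⟩, rfl⟩
      · rintro ⟨⟨h, _⟩, h'⟩
        exact ⟨h, h'⟩
    · intro q hq
      rw [Finset.mem_filter] at hq
      exact Finset.mem_Ico.2 ⟨(hj q hq.1).1 hq.2, hlt k q hq.1⟩
  rw [hwt, ← e2]
  linarith

end System
end LampAux

namespace LampAux

theorem seg_aux (lo g : ℤ) (h : lo < g) :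
    ∃ (p : ℕ) (J : Finset ℤ), J ⊆ Finset.Ioc lo g ∧ g - lo ≤ 4 * J.card ∧
      ∀ j ∈ J, j.natAbs ≤ p ∧ p ≤ 2 * j.natAbs := by
  rcases le_total (lo + 1).natAbs g.natAbs with hc | hc
  · refine ⟨g.natAbs, Finset.Ioc (g - (g - lo + 3) / 4) g, ?_, ?_, ?_⟩
    · intro j; simp only [Finset.mem_Ioc]; omega
    · rw [Int.card_Ioc]; omega
    · intro j; simp only [Finset.mem_Ioc]; omega
  · refine ⟨(lo + 1).natAbs, Finset.Ioc lo (lo + (g - lo + 3) / 4), ?_, ?_, ?_⟩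
    · intro j; simp only [Finset.mem_Ioc]; omega
    · rw [Int.card_Ioc]; omega
    · intro j; simp only [Finset.mem_Ioc]; omega

theorem segment (a : ℕ) (lo g : ℤ) (h : lo ≤ g) :
    ∃ k, g - lo ≤ 8 * ((Finset.Ioc lo g).filter
      fun j => Nat.log 2 (max j.natAbs a) = k).card := by
  rcases h.eq_or_lt with h | h
  · exact ⟨0, by omega⟩
  obtain ⟨p, J, hJ, hc, hj⟩ := seg_aux lo g h
  set K := Nat.log 2 (max p a) with hK
  have hlog : ∀ j ∈ J, Nat.log 2 (max j.natAbs a) = K ∨ Nat.log 2 (max j.natAbs a) = K - 1 := by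
    intro j hjJ
    obtain ⟨h1, h2⟩ := hj j hjJ
    have u1 : Nat.log 2 (max j.natAbs a) ≤ K := Nat.log_mono_right (by omega)
    have u2 : K ≤ Nat.log 2 (max j.natAbs a * 2) := Nat.log_mono_right (by omega)
    rcases eq_or_ne (max j.natAbs a) 0 with h0 | h0
    · rw [h0] at u1 u2 ⊢
      simp at u2
      left; simp [u2]
    · rw [Nat.log_mul_base (by norm_num) h0] at u2
      omega
  have hsub : J ⊆ ((Finset.Ioc lo g).filter fun j => Nat.log 2 (max j.natAbs a) = K) ∪
      ((Finset.Ioc lo g).filter fun j => Nat.log 2 (max j.natAbs a) = K - 1) := by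
    intro j hjJ
    have := hlog j hjJ
    have := hJ hjJ
    simp only [Finset.mem_union, Finset.mem_filter]
    tauto
  have := (Finset.card_le_card hsub).trans (Finset.card_union_le _ _)
  by_contra hcon
  push Not at hcon
  have := hcon K
  have := hcon (K - 1)
  omega

/-- Lower part of a configuration. -/
def cutx (x : Finset ℤ) (j : ℤ) : Finset ℤ := x.filter (· ≤ j)

/-- Size of a node. -/
def size (u : LampZ) : ℕ := max u.2.natAbs (u.1.sup Int.natAbs)

/-- Level of a node. -/
def kap (q : Bool × LampZ) : ℕ := 2 * Nat.log 2 (size q.2) + q.1.toNat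

theorem kap_finite (k : ℕ) : {q | kap q = k}.Finite := by
  apply Set.Finite.subset (s := ((Finset.univ : Finset Bool) ×ˢ
    (((Finset.Icc (-2 ^ (k + 1)) (2 ^ (k + 1)) : Finset ℤ)).powerset ×ˢ
      (Finset.Icc (-2 ^ (k + 1)) (2 ^ (k + 1)) : Finset ℤ)) : Finset (Bool × LampZ)))
  · exact Finset.finite_toSet _
  · rintro ⟨b, x, j⟩ hq
    simp only [Set.mem_setOf_eq, kap] at hq
    have h1 : size (x, j) < 2 ^ (k + 1) := by
      have := Nat.lt_pow_succ_log_self (b := 2) (by norm_num) (size (x, j))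
      exact this.trans_le (Nat.pow_le_pow_right (by norm_num) (by omega))
    have h2 : j.natAbs < 2 ^ (k + 1) := (le_max_left _ _).trans_lt h1
    have h3 : ∀ i ∈ x, i.natAbs < 2 ^ (k + 1) := fun i hi =>
      ((Finset.le_sup (f := Int.natAbs) hi).trans (le_max_right _ _)).trans_lt h1
    have cv : ∀ i : ℤ, i.natAbs < 2 ^ (k + 1) → -2 ^ (k + 1) ≤ i ∧ i ≤ 2 ^ (k + 1) := by
      intro i hi
      zify at hi
      have := abs_lt.1 hi
      exact ⟨this.1.le, this.2.le⟩
    simp only [Finset.coe_product, Set.mem_prod, Finset.mem_coe, Finset.mem_univ, true_and,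
      Finset.mem_powerset, Finset.mem_Icc]
    refine ⟨fun i hi => Finset.mem_Icc.2 (cv i (h3 i hi)), cv j h2⟩

theorem size_cut (x : Finset ℤ) (j : ℤ) :
    size (cutx x j, j) = max j.natAbs (x.sup fun i => (-i).toNat) := by
  simp only [size]
  apply le_antisymm
  · refine max_le (le_max_left _ _) (Finset.sup_le fun i hi => ?_)
    rw [cutx, Finset.mem_filter] at hi
    have : (-i).toNat ≤ x.sup fun i => (-i).toNat :=
      Finset.le_sup (f := fun i : ℤ => (-i).toNat) hi.1
    omega
  · refine max_le (le_max_left _ _) (Finset.sup_le fun i hi => ?_)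
    by_cases h : i ≤ j
    · have : i.natAbs ≤ (cutx x j).sup Int.natAbs :=
        Finset.le_sup (f := Int.natAbs) (Finset.mem_filter.2 ⟨hi, h⟩)
      omega
    · omega

/-- Order value of a configuration. -/
noncomputable def vl (x : Finset ℤ) : ℝ := ∑ i ∈ x, ((1 : ℝ) / 3) ^ i

theorem vl_mono {x y : Finset ℤ} (h : x ⊆ y) : vl x ≤ vl y :=
  Finset.sum_le_sum_of_subset_of_nonneg h fun i _ _ => by positivity

theorem geom (m j : ℤ) (h : m ≤ j) :
    ∑ i ∈ Finset.Ioc m j, ((1 : ℝ) / 3) ^ i < (1 / 3) ^ m := by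
  have key : ∑ i ∈ Finset.Ioc m j, ((1 : ℝ) / 3) ^ i = ((1 / 3) ^ m - (1 / 3) ^ j) / 2 := by
    induction j, h using Int.le_induction with
    | base => simp
    | succ j hj ih =>
      have : Finset.Ioc m (j + 1) = insert (j + 1) (Finset.Ioc m j) := by
        ext i; simp only [Finset.mem_Ioc, Finset.mem_insert]; omega
      rw [this, Finset.sum_insert (by simp), ih, zpow_add₀ (by norm_num)]
      ring
  have h1 : (0 : ℝ) < (1 / 3) ^ m := by positivity
  have h2 : (0 : ℝ) < (1 / 3) ^ j := by positivity
  rw [key]; linarith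

theorem vl_lt (x y : Finset ℤ) (lo : ℤ) (hag : ∀ i ≤ lo, (i ∈ x ↔ i ∈ y))
    (hx : lo + 1 ∉ x) (hy : lo + 1 ∈ y) (j : ℤ) (hj : lo < j) :
    vl (cutx x j) < vl (cutx y (lo + 1)) := by
  have h1 : cutx y (lo + 1) = insert (lo + 1) (cutx y lo) := by
    ext i
    simp only [cutx, Finset.mem_filter, Finset.mem_insert]
    constructor
    · rintro ⟨h, h'⟩
      rcases h'.eq_or_lt with h2 | h2
      · exact Or.inl h2
      · exact Or.inr ⟨h, by omega⟩
    · rintro (rfl | h)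
      · exact ⟨hy, le_rfl⟩
      · exact ⟨h.1, by omega⟩
  have h2 : cutx x j ⊆ cutx y lo ∪ Finset.Ioc (lo + 1) j := by
    intro i hi
    simp only [cutx, Finset.mem_filter, Finset.mem_union, Finset.mem_Ioc] at hi ⊢
    by_cases h : i ≤ lo
    · exact Or.inl ⟨(hag i h).1 hi.1, h⟩
    · have : i ≠ lo + 1 := fun h => hx (h ▸ hi.1)
      right; omega
  have h3 : Disjoint (cutx y lo) (Finset.Ioc (lo + 1) j) := by
    rw [Finset.disjoint_left]
    intro i hi
    simp only [cutx, Finset.mem_filter, Finset.mem_Ioc] at hi ⊢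
    omega
  refine (vl_mono h2).trans_lt ?_
  have h4 := geom (lo + 1) j (by omega)
  rw [vl, vl, h1, Finset.sum_union h3, Finset.sum_insert (by simp [cutx])]
  linarith

end LampAux

namespace LampAux

/-- Formal sum of the nodes on a path. -/
noncomputable def pth (b : Bool) (x : Finset ℤ) (lo g : ℤ) : (Bool × LampZ) →₀ ℝ :=
  ∑ j ∈ Finset.Ioc lo g, Finsupp.single (b, (cutx x j, j)) (1 : ℝ)

theorem pth_split (b : Bool) (x : Finset ℤ) (l lo g : ℤ) (h1 : l ≤ lo) (h2 : lo ≤ g) :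
    pth b x l g = pth b x l lo + pth b x lo g := by
  rw [pth, pth, pth, ← Finset.sum_union]
  · refine Finset.sum_congr ?_ fun _ _ => rfl
    ext j; simp only [Finset.mem_Ioc, Finset.mem_union]; omega
  · rw [Finset.disjoint_left]
    intro j; simp only [Finset.mem_Ioc]; omega

theorem pth_congr (b : Bool) (x y : Finset ℤ) (l lo : ℤ) (h : ∀ i ≤ lo, (i ∈ x ↔ i ∈ y)) :
    pth b x l lo = pth b y l lo := by
  refine Finset.sum_congr rfl fun j hj => ?_
  have : cutx x j = cutx y j := by
    ext i
    simp only [cutx, Finset.mem_filter]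
    rw [Finset.mem_Ioc] at hj
    constructor
    · rintro ⟨h1, h2⟩
      exact ⟨(h i (by omega)).1 h1, h2⟩
    · rintro ⟨h1, h2⟩
      exact ⟨(h i (by omega)).2 h1, h2⟩
  rw [this]

/-- Admissible base points. -/
def Good (l : ℤ) (u : LampZ) : Prop := l ≤ u.2 ∧ l ≤ 0 ∧ ∀ i ∈ u.1, l < i

theorem exists_good (u : LampZ) : ∃ l, Good l u := by
  refine ⟨-(u.2.natAbs + u.1.sup Int.natAbs + 1), by omega, by omega, fun i hi => ?_⟩
  have : i.natAbs ≤ u.1.sup Int.natAbs := Finset.le_sup (f := Int.natAbs) hi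
  omega

theorem Good.anti {l l' : ℤ} {u : LampZ} (h : Good l u) (hl : l' ≤ l) : Good l' u :=
  ⟨hl.trans h.1, hl.trans h.2.1, fun i hi => hl.trans_lt (h.2.2 i hi)⟩

/-- The formal embedding. -/
noncomputable def Fm (b : Bool) (u : LampZ) : (Bool × LampZ) →₀ ℝ :=
  pth b u.1 (exists_good u).choose u.2 - pth b ∅ (exists_good u).choose 0

theorem Fm_eq_aux (b : Bool) (u : LampZ) (l l' : ℤ) (h : Good l u) (hl : l' ≤ l) :
    pth b u.1 l' u.2 - pth b ∅ l' 0 = pth b u.1 l u.2 - pth b ∅ l 0 := by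
  rw [pth_split b u.1 l' l u.2 hl h.1, pth_split b ∅ l' l 0 hl h.2.1,
    pth_congr b u.1 ∅ l' l fun i hi => ?_]
  · abel
  · constructor
    · intro h'
      have := h.2.2 i h'
      omega
    · intro h'; simp at h'

theorem Fm_eq (b : Bool) (u : LampZ) (l : ℤ) (h : Good l u) :
    Fm b u = pth b u.1 l u.2 - pth b ∅ l 0 := by
  have h' := (exists_good u).choose_spec
  rw [Fm]
  rcases le_total l (exists_good u).choose with hl | hl
  · exact (Fm_eq_aux b u _ _ h' hl).symm
  · exact Fm_eq_aux b u _ _ h hl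

theorem Fm_sub (b : Bool) (u v : LampZ) (lo : ℤ) (h1 : lo ≤ u.2) (h2 : lo ≤ v.2)
    (h : ∀ i ≤ lo, (i ∈ u.1 ↔ i ∈ v.1)) :
    Fm b u - Fm b v = pth b u.1 lo u.2 - pth b v.1 lo v.2 := by
  obtain ⟨l₁, hl₁⟩ := exists_good u
  obtain ⟨l₂, hl₂⟩ := exists_good v
  have hl : min (min l₁ l₂) lo ≤ lo := min_le_right _ _
  rw [Fm_eq b u (min (min l₁ l₂) lo) (hl₁.anti (by omega)),
    Fm_eq b v (min (min l₁ l₂) lo) (hl₂.anti (by omega)),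
    pth_split b u.1 _ lo u.2 hl h1, pth_split b v.1 _ lo v.2 hl h2,
    pth_congr b u.1 v.1 _ lo h]
  abel

/-- Reflection of the line. -/
def rfx (u : LampZ) : LampZ := (u.1.image fun i => 1 - i, -u.2)

theorem mem_rfx (u : LampZ) (i : ℤ) : i ∈ (rfx u).1 ↔ 1 - i ∈ u.1 := by
  simp only [rfx, Finset.mem_image]
  constructor
  · rintro ⟨j, hj, rfl⟩
    simpa using hj
  · intro h
    exact ⟨1 - i, h, by ring⟩

theorem rfx_up (u v : LampZ) (h : Up u v) : Up (rfx v) (rfx u) := by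
  obtain ⟨h1, h2⟩ := h
  constructor
  · simp only [rfx]; omega
  · intro j hj
    rw [mem_rfx, mem_rfx]
    exact (h2 _ (by simp only [rfx] at hj; omega)).symm

theorem exists_lo (u v : LampZ) : ∃ lo, lo ≤ u.2 ∧ lo ≤ v.2 ∧
    (∀ i ≤ lo, (i ∈ u.1 ↔ i ∈ v.1)) ∧
    (lo = u.2 ∨ lo = v.2 ∨ ¬ (lo + 1 ∈ u.1 ↔ lo + 1 ∈ v.1)) := by
  have hs : ∀ i, i ∈ u.1 ∆ v.1 ↔ ¬ (i ∈ u.1 ↔ i ∈ v.1) := by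
    intro i; rw [Finset.mem_symmDiff]; tauto
  rcases (u.1 ∆ v.1).eq_empty_or_nonempty with h0 | h0
  · refine ⟨min u.2 v.2, min_le_left _ _, min_le_right _ _, fun i _ => ?_, by omega⟩
    by_contra h
    rw [← hs, h0] at h
    simp at h
  · have hmin := Finset.min'_mem _ h0
    have hle := fun i hi => Finset.min'_le (u.1 ∆ v.1) i hi
    set m := (u.1 ∆ v.1).min' h0
    refine ⟨min (min u.2 v.2) (m - 1), by omega, by omega, fun i hi => ?_, ?_⟩
    · by_contra h
      rw [← hs] at h
      have := hle i h
      omega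
    · by_cases h : m - 1 < min u.2 v.2
      · right; right
        rw [← hs, show min (min u.2 v.2) (m - 1) + 1 = m by omega]
        exact hmin
      · omega

theorem wt_pth_ne (k : ℕ) (P : Bool × LampZ → Prop) (b : Bool) (x : Finset ℤ) (lo g : ℤ)
    (hk : ∀ j ∈ Finset.Ioc lo g, ¬ (kap (b, (cutx x j, j)) = k ∧ P (b, (cutx x j, j)))) :
    wt kap k P (pth b x lo g) = 0 := by
  classical
  rw [pth, map_sum]
  refine Finset.sum_eq_zero fun j hj => ?_
  simp only [wt, Finsupp.linearCombination_single]
  rw [if_neg (hk j hj), smul_zero]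

theorem wt_pth_all (k : ℕ) (P : Bool × LampZ → Prop) (b : Bool) (x : Finset ℤ) (lo g : ℤ)
    (hk : ∀ j ∈ Finset.Ioc lo g, P (b, (cutx x j, j))) :
    wt kap (2 * k + b.toNat) P (pth b x lo g) = ((Finset.Ioc lo g).filter
      fun j => Nat.log 2 (max j.natAbs (x.sup fun i => (-i).toNat)) = k).card := by
  classical
  rw [pth, map_sum, Finset.card_filter, Nat.cast_sum]
  refine Finset.sum_congr rfl fun j hj => ?_
  simp only [wt, Finsupp.linearCombination_single, kap, size_cut]
  simp [hk j hj]

theorem wt_compl (k : ℕ) (P : Bool × LampZ → Prop) (a : (Bool × LampZ) →₀ ℝ) :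
    wt kap k (fun q => ¬ P q) a = wt kap k (fun _ => True) a - wt kap k P a := by
  classical
  simp only [wt, Finsupp.linearCombination_apply, Finsupp.sum]
  rw [← Finset.sum_sub_distrib]
  refine Finset.sum_congr rfl fun q _ => ?_
  by_cases h1 : kap q = k <;> by_cases h2 : P q <;> simp [h1, h2]

theorem wt_other (k : ℕ) (P : Bool × LampZ → Prop) (b : Bool) (x : Finset ℤ) (lo g : ℤ) :
    wt kap (2 * k + (!b).toNat) P (pth b x lo g) = 0 := by
  apply wt_pth_ne
  rintro j - ⟨h, -⟩
  simp only [kap] at h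
  cases b <;> simp at h <;> omega

theorem wt_Fm_other (k : ℕ) (P : Bool × LampZ → Prop) (b : Bool) (u : LampZ) :
    wt kap (2 * k + (!b).toNat) P (Fm b u) = 0 := by
  rw [Fm, map_sub, wt_other, wt_other, sub_zero]

/-- The order value of a node. -/
noncomputable def vq (q : Bool × LampZ) : ℝ := vl q.2.1

theorem lower_one (b : Bool) (u v : LampZ) (lo : ℤ) (h1 : lo ≤ u.2) (h2 : lo ≤ v.2)
    (h : ∀ i ≤ lo, (i ∈ u.1 ↔ i ∈ v.1))
    (hbr : lo = u.2 ∨ lo = v.2 ∨ ¬ (lo + 1 ∈ u.1 ↔ lo + 1 ∈ v.1)) (N : ℝ)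
    (hN0 : 0 ≤ N)
    (hN : ∀ (P : Bool × LampZ → Prop), (∀ q q', P q → vq q ≤ vq q' → P q') → ∀ k,
      |wt kap (2 * k + b.toNat) P (Fm b u - Fm b v)| ≤ 32 * N) :
    ((u.2 - lo : ℤ) : ℝ) ≤ 512 * N := by
  obtain ⟨k, hk⟩ := segment (u.1.sup fun i => (-i).toNat) lo u.2 h1
  have hk' : ((u.2 - lo : ℤ) : ℝ) ≤ 8 * (((Finset.Ioc lo u.2).filter
      fun j => Nat.log 2 (max j.natAbs (u.1.sup fun i => (-i).toNat)) = k).card : ℝ) := by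
    exact_mod_cast hk
  refine hk'.trans ?_
  rw [Fm_sub b u v lo h1 h2 h] at hN
  rcases hbr with hb | hb | hb
  · rw [← hb]; simp; positivity
  · have := hN (fun _ => True) (fun _ _ _ _ => trivial) k
    rw [map_sub, wt_pth_all k _ b u.1 lo u.2 fun _ _ => trivial,
      wt_pth_ne _ _ _ v.1 lo v.2 fun j hj => by
        rw [Finset.mem_Ioc] at hj; omega, sub_zero] at this
    have := (abs_le.1 this).2
    linarith
  · by_cases hu : lo + 1 ∈ u.1
    · have hv : lo + 1 ∉ v.1 := fun h => hb ⟨fun _ => h, fun _ => hu⟩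
      have := hN (fun q => vl (cutx u.1 (lo + 1)) ≤ vq q) (fun _ _ a b => a.trans b) k
      rw [map_sub, wt_pth_all k _ b u.1 lo u.2 fun j hj => ?_,
        wt_pth_ne _ _ _ v.1 lo v.2 fun j hj => ?_, sub_zero] at this
      · have := (abs_le.1 this).2
        linarith
      · rw [Finset.mem_Ioc] at hj
        rintro ⟨-, h'⟩
        exact absurd h' (not_le.2 (vl_lt v.1 u.1 lo (fun i hi => (h i hi).symm) hv hu j hj.1))
      · rw [Finset.mem_Ioc] at hj
        refine vl_mono fun i hi => ?_
        rw [cutx, Finset.mem_filter] at hi ⊢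
        exact ⟨hi.1, by omega⟩
    · have hv : lo + 1 ∈ v.1 := by by_contra h; exact hb ⟨fun h' => absurd h' hu, fun h' => absurd h' h⟩
      have a1 := hN (fun q => vl (cutx v.1 (lo + 1)) ≤ vq q) (fun _ _ a b => a.trans b) k
      have a2 := hN (fun _ => True) (fun _ _ _ _ => trivial) k
      have a3 := wt_compl (2 * k + b.toNat) (fun q => vl (cutx v.1 (lo + 1)) ≤ vq q)
        (pth b u.1 lo u.2 - pth b v.1 lo v.2)
      rw [map_sub (wt kap (2 * k + b.toNat) fun q => ¬ vl (cutx v.1 (lo + 1)) ≤ vq q),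
        wt_pth_all k _ b u.1 lo u.2 fun j hj => ?_,
        wt_pth_ne _ _ _ v.1 lo v.2 fun j hj => ?_, sub_zero] at a3
      · rw [abs_le] at a1 a2
        linarith [a1.1, a2.2]
      · rw [Finset.mem_Ioc] at hj
        rintro ⟨-, h'⟩
        refine h' (vl_mono fun i hi => ?_)
        rw [cutx, Finset.mem_filter] at hi ⊢
        exact ⟨hi.1, by omega⟩
      · rw [Finset.mem_Ioc] at hj
        exact not_le.2 (vl_lt u.1 v.1 lo h hu hv j hj.1)

section Emb
variable {X : Type*} [NormedAddCommGroup X] [NormedSpace ℝ X]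

theorem exists_embedding (hJ : ∀ n, ∃ y : ℕ → X, JFam 4 n y) :
    ∃ D : ℝ, 1 ≤ D ∧ ∃ (f : LampZ → X) (r : ℝ), 0 < r ∧
        ∀ u v : LampZ,
          r * (lampZDist u v : ℝ) ≤ ‖f u - f v‖ ∧
          ‖f u - f v‖ ≤ D * r * (lampZDist u v : ℝ) := by
  obtain ⟨e, he1, he2⟩ := exists_system hJ kap kap_finite vq
  let Φ := Finsupp.linearCombination ℝ e
  let G : LampZ → (Bool × LampZ) →₀ ℝ := fun u => Fm false u + Fm true (rfx u)
  have hup : ∀ b u v, Up u v → ‖Φ (Fm b u - Fm b v)‖ ≤ 1 := by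
    intro b u v h
    rw [Fm_sub b u v u.2 le_rfl (by rw [h.1]; omega) fun i hi => (h.2 i (by omega)).symm]
    have e1 : pth b u.1 u.2 u.2 = 0 := by simp [pth]
    have e2 : pth b v.1 u.2 v.2 = Finsupp.single (b, (cutx v.1 v.2, v.2)) 1 := by
      have : Finset.Ioc u.2 v.2 = {v.2} := by
        ext j; rw [h.1]; simp only [Finset.mem_Ioc, Finset.mem_singleton]; omega
      rw [pth, this, Finset.sum_singleton]
    rw [e1, e2, zero_sub, map_neg, norm_neg, Finsupp.linearCombination_single, one_smul]
    exact he1 _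
  have hG : ∀ u v, Φ (G u) - Φ (G v) =
      Φ (Fm false u - Fm false v) + Φ (Fm true (rfx u) - Fm true (rfx v)) := by
    intro u v
    simp only [G, map_add, map_sub]; abel
  have hup2 : ∀ u v, Up u v → ‖Φ (G u) - Φ (G v)‖ ≤ 2 := by
    intro u v h
    rw [hG]
    refine (norm_add_le _ _).trans ?_
    have a1 := hup false u v h
    have a2 := hup true _ _ (rfx_up u v h)
    rw [← neg_sub, map_neg, norm_neg] at a2
    linarith
  have hlip : ∀ n u v, Reach u v n → ‖Φ (G u) - Φ (G v)‖ ≤ 2 * n := by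
    intro n
    induction n with
    | zero => intro u v h; rw [h.zero]; simp
    | succ n ih =>
      intro u v h
      obtain ⟨z, hz, hr⟩ := h.cases_succ
      have a1 := ih z v hr
      have a2 : ‖Φ (G u) - Φ (G z)‖ ≤ 2 := by
        rcases hz with hz | hz
        · exact hup2 u z hz
        · rw [norm_sub_rev]; exact hup2 z u hz
      have a3 := norm_sub_le_norm_sub_add_norm_sub (Φ (G u)) (Φ (G z)) (Φ (G v))
      push_cast
      linarith
  have hf : ∀ u v, ∀ (P : Bool × LampZ → Prop), (∀ q q', P q → vq q ≤ vq q' → P q') → ∀ k,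
      |wt kap (2 * k + false.toNat) P (Fm false u - Fm false v)| ≤
        32 * ‖Φ (G u) - Φ (G v)‖ := by
    intro u v P hP k
    have := he2 P hP (2 * k + false.toNat) (G u - G v)
    rw [map_sub (Finsupp.linearCombination ℝ e)] at this
    convert this using 2
    have o1 := wt_Fm_other k P true (rfx u)
    have o2 := wt_Fm_other k P true (rfx v)
    rw [Bool.not_true] at o1 o2
    simp only [G, map_sub, map_add, o1, o2, add_zero]
  have ht : ∀ u v, ∀ (P : Bool × LampZ → Prop), (∀ q q', P q → vq q ≤ vq q' → P q') → ∀ k,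
      |wt kap (2 * k + true.toNat) P (Fm true (rfx u) - Fm true (rfx v))| ≤
        32 * ‖Φ (G u) - Φ (G v)‖ := by
    intro u v P hP k
    have := he2 P hP (2 * k + true.toNat) (G u - G v)
    rw [map_sub (Finsupp.linearCombination ℝ e)] at this
    convert this using 2
    have o1 := wt_Fm_other k P false u
    have o2 := wt_Fm_other k P false v
    rw [Bool.not_false] at o1 o2
    simp only [G, map_sub, map_add, o1, o2, zero_add]
  refine ⟨4096, by norm_num, fun u => Φ (G u), 1 / 2048, by norm_num, fun u v => ⟨?_, ?_⟩⟩
  · obtain ⟨lo, l1, l2, l3, l4⟩ := exists_lo u v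
    obtain ⟨lo', m1, m2, m3, m4⟩ := exists_lo (rfx u) (rfx v)
    set N := ‖Φ (G u) - Φ (G v)‖ with hNd
    have hN0 : 0 ≤ N := norm_nonneg _
    have b1 := lower_one false u v lo l1 l2 l3 l4 N hN0 (hf u v)
    have b3 := lower_one true _ _ lo' m1 m2 m3 m4 N hN0 (ht u v)
    have b4 := lower_one true _ _ lo' m2 m1 (fun i hi => (m3 i hi).symm) (by tauto) N hN0
      (by rw [hNd, norm_sub_rev]; exact ht v u)
    simp only [rfx] at m1 m2 b3 b4
    have hr := reach_upper u v lo (-lo') l1 l2 (by omega) (by omega) (by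
      intro j hj
      constructor
      · by_contra hc
        exact hj (l3 j (by omega))
      · by_contra hc
        have := m3 (1 - j) (by omega)
        rw [mem_rfx, mem_rfx] at this
        simp only [sub_sub_cancel] at this
        exact hj this)
    have hd : ((lampZDist u v : ℕ) : ℤ) ≤ (u.2 - lo) + (-lo' - lo) + (-lo' - v.2) := by
      have := dist_le hr
      omega
    have hd' : ((lampZDist u v : ℕ) : ℝ) ≤
        ((((u.2 - lo) + (-lo' - lo) + (-lo' - v.2) : ℤ)) : ℝ) := by exact_mod_cast hd
    push_cast at hd' b1 b3 b4
    linarith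
  · have := hlip _ u v (reach_lampZDist u v)
    linarith

theorem embeds_of_not_uc (h : ¬ HasEquivUnifConvexNorm X) :
    ∃ D : ℝ, 1 ≤ D ∧ ∃ (f : LampZ → X) (r : ℝ), 0 < r ∧
        ∀ u v : LampZ,
          r * (lampZDist u v : ℝ) ≤ ‖f u - f v‖ ∧
          ‖f u - f v‖ ≤ D * r * (lampZDist u v : ℝ) := by
  obtain ⟨ε, hε, hD⟩ := exists_Der_nonempty h
  exact exists_embedding fun n => exists_JX ε hε hD n

end Emb
end LampAux

/-- A Banach space is non-superreflexive iff the infinite lamplighter group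
`Z₂ ≀ Z` (with word metric w.r.t. `{t, ta}`) admits a bilipschitz embedding into it
with some finite distortion. -/
theorem nonsuperreflexive_iff_infinite_lamplighter_embeds
    (X : Type*) [NormedAddCommGroup X] [NormedSpace ℝ X] [CompleteSpace X] :
    (¬ HasEquivUnifConvexNorm X) ↔
      ∃ D : ℝ, 1 ≤ D ∧ ∃ (f : LampZ → X) (r : ℝ), 0 < r ∧
        ∀ u v : LampZ,
          r * (lampZDist u v : ℝ) ≤ ‖f u - f v‖ ∧
          ‖f u - f v‖ ≤ D * r * (lampZDist u v : ℝ) := by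
  constructor
  · intro h
    exact LampAux.embeds_of_not_uc h
  · rintro ⟨D, hD, f, r, hr, hf⟩
    exact LampAux.not_uc_of_embeds D hD f r hr hf
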